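/- arXiv:math/0407306 — 10 statements merged into one kernel-verified Lean document; each statement's English description precedes it below -/
import Mathlib

section
/- (Fraenkel's Partition Theorem, rational case.) Let q > 1 and p_1, p_2 be positive integers and r_1, r_2 be integers. The sets B_{p_1,r_1}^q and B_{p_2,r_2}^q partition ℤ (i.e., they are disjoint and their union is all of ℤ) if and only if p_1 + p_2 = q and p_1·r_1 + p_2·r_2 ≡ −gcd(p_1, q) (mod q). -/
/-- The rational Beatty set `B_{p,r}^q = {⌊nq/p + r⌋ : n ∈ ℤ}`. -/
def beattySet (p q r : ℤ) : Set ℤ := {x | ∃ n : ℤ, ⌊((n : ℚ) * q / p + r)⌋ = x}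

theorem mem_beattySet_iff {p q r x : ℤ} (hq : 0 < q) (hp : 0 < p) :
    x ∈ beattySet p q r ↔ p * (r - x) % q < p := by
  have hpQ : (0 : ℚ) < p := by exact_mod_cast hp
  have key (n : ℤ) : ⌊((n : ℚ) * q / p + r)⌋ = x ↔
      p * (x - r) ≤ n * q ∧ n * q < p * (x - r) + p := by
    rw [Int.floor_eq_iff, ← sub_le_iff_le_add, le_div_iff₀ hpQ, ← lt_sub_iff_add_lt,
      div_lt_iff₀ hpQ]
    have h₁ : ((x : ℚ) - r) * p ≤ n * q ↔ p * (x - r) ≤ n * q := by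
      rw [mul_comm]; exact_mod_cast Iff.rfl
    have h₂ : (n : ℚ) * q < (x + 1 - r) * p ↔ n * q < p * (x - r) + p := by
      rw [show ((x : ℚ) + 1 - r) * p = p * (x - r) + p by ring]; exact_mod_cast Iff.rfl
    rw [h₁, h₂]
  have hdiv := Int.emod_add_mul_ediv (p * (r - x)) q
  have hnonneg := Int.emod_nonneg (p * (r - x)) hq.ne'
  have hlt := Int.emod_lt_of_pos (p * (r - x)) hq
  simp only [beattySet, Set.mem_ofPred_eq, key]
  constructor
  · rintro ⟨n, h₁, h₂⟩
    have hn : 0 ≤ n + p * (r - x) / q := by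
      by_contra! h
      nlinarith
    nlinarith
  · intro h
    exact ⟨-(p * (r - x) / q), by linarith, by linarith⟩

theorem nonempty_beattySet (p q r : ℤ) : (beattySet p q r).Nonempty := ⟨_, 0, rfl⟩

theorem lt_of_beattySet_ne_univ {p q r : ℤ} (hq : 0 < q) (hp : 0 < p)
    (h : beattySet p q r ≠ Set.univ) : p < q := by
  by_contra! hle
  exact h (Set.eq_univ_of_forall fun x =>
    (mem_beattySet_iff hq hp).2 ((Int.emod_lt_of_pos _ hq).trans_le hle))

theorem ediv_sub_ediv_succ {p q r : ℤ} (hq : 0 < q) (hp : 0 < p) (hpq : p < q) (x : ℤ)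
    [Decidable (x ∈ beattySet p q r)] :
    p * (r - x) / q - p * (r - (x + 1)) / q = if x ∈ beattySet p q r then 1 else 0 := by
  have hdiv := Int.emod_add_mul_ediv (p * (r - x)) q
  have hnonneg := Int.emod_nonneg (p * (r - x)) hq.ne'
  have hlt := Int.emod_lt_of_pos (p * (r - x)) hq
  split_ifs with h
  · rw [mem_beattySet_iff hq hp] at h
    have : p * (r - (x + 1)) / q = p * (r - x) / q - 1 := by
      rw [Int.ediv_eq_iff_of_pos hq]
      constructor <;> linarith
    omega
  · rw [mem_beattySet_iff hq hp] at h
    have : p * (r - (x + 1)) / q = p * (r - x) / q := by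
      rw [Int.ediv_eq_iff_of_pos hq]
      constructor <;> linarith
    omega

theorem emod_le_sub_of_dvd {a q d : ℤ} (hq : 0 < q) (hdq : d ∣ q) (hda : d ∣ a) :
    a % q ≤ q - d := by
  have h : d ∣ q - a % q := dvd_sub hdq ((EuclideanDomain.dvd_mod_iff hdq).2 hda)
  have := Int.le_of_dvd (sub_pos.2 (Int.emod_lt_of_pos a hq)) h
  linarith

theorem partition_iff_xor {α : Type*} {s t : Set α} :
    (s ∩ t = ∅ ∧ s ∪ t = Set.univ) ↔ ∀ x, (x ∈ s ↔ x ∉ t) := by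
  simp only [Set.eq_empty_iff_forall_notMem, Set.eq_univ_iff_forall, Set.mem_inter_iff,
    Set.mem_union, ← forall_and]
  exact forall_congr' fun x => by tauto

/-- The quotients of the two sequences add up to a sequence decreasing by `1` at each step. -/
theorem ediv_add_ediv_of_partition {q p₁ p₂ r₁ r₂ : ℤ} (hq : 0 < q) (hp₁ : 0 < p₁) (hp₂ : 0 < p₂)
    (hlt₁ : p₁ < q) (hlt₂ : p₂ < q)
    (h : ∀ x, (x ∈ beattySet p₁ q r₁ ↔ x ∉ beattySet p₂ q r₂)) (x : ℤ) :
    p₁ * (r₁ - x) / q + p₂ * (r₂ - x) / q = p₁ * r₁ / q + p₂ * r₂ / q - x := by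
  classical
  have step (x : ℤ) : p₁ * (r₁ - x) / q + p₂ * (r₂ - x) / q =
      p₁ * (r₁ - (x + 1)) / q + p₂ * (r₂ - (x + 1)) / q + 1 := by
    have h₁ := ediv_sub_ediv_succ (r := r₁) hq hp₁ hlt₁ x
    have h₂ := ediv_sub_ediv_succ (r := r₂) hq hp₂ hlt₂ x
    have hx := h x
    split_ifs at h₁ h₂ <;> first | omega | tauto
  induction x using Int.induction_on with
  | zero => simp
  | succ n ih => linarith [step n]
  | pred n ih =>
    have := step (-n - 1)
    rw [sub_add_cancel] at this
    linarith

theorem mem_iff_notMem_of_modEq {q p₁ p₂ r₁ r₂ : ℤ} (hq : 0 < q) (hp₁ : 0 < p₁) (hp₂ : 0 < p₂)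
    (hsum : p₁ + p₂ = q) (hmod : p₁ * r₁ + p₂ * r₂ ≡ -(Int.gcd p₁ q : ℤ) [ZMOD q]) (x : ℤ) :
    x ∈ beattySet p₁ q r₁ ↔ x ∉ beattySet p₂ q r₂ := by
  rw [mem_beattySet_iff hq hp₁, mem_beattySet_iff hq hp₂]
  have hd : (0 : ℤ) < Int.gcd p₁ q := by exact_mod_cast Int.gcd_pos_of_ne_zero_left _ hp₁.ne'
  have hd₁ : (Int.gcd p₁ q : ℤ) ∣ p₁ := Int.gcd_dvd_left ..
  have hdq : (Int.gcd p₁ q : ℤ) ∣ q := Int.gcd_dvd_right ..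
  have hd₂ : (Int.gcd p₁ q : ℤ) ∣ p₂ := by
    rw [← hsum] at hdq ⊢
    exact (dvd_add_right (by rwa [hsum])).1 hdq
  generalize (Int.gcd p₁ q : ℤ) = d at *
  have ha := emod_le_sub_of_dvd hq hdq (hd₁.mul_right (r₁ - x))
  have hb := emod_le_sub_of_dvd hq hdq (hd₂.mul_right (r₂ - x))
  have ha₀ := Int.emod_nonneg (p₁ * (r₁ - x)) hq.ne'
  have hb₀ := Int.emod_nonneg (p₂ * (r₂ - x)) hq.ne'
  have hda : d ∣ p₁ * (r₁ - x) % q := (EuclideanDomain.dvd_mod_iff hdq).2 (hd₁.mul_right _)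
  have ediv₁ := Int.emod_add_mul_ediv (p₁ * (r₁ - x)) q
  have ediv₂ := Int.emod_add_mul_ediv (p₂ * (r₂ - x)) q
  obtain ⟨k, hk⟩ := hmod.dvd
  generalize p₁ * (r₁ - x) % q = a at *
  generalize p₂ * (r₂ - x) % q = b at *
  have hab : a + b = q - d := by
    obtain ⟨m, hm⟩ : ∃ m, a + b + d = q * m :=
      ⟨-k - x - p₁ * (r₁ - x) / q - p₂ * (r₂ - x) / q, by
        linear_combination ediv₁ + ediv₂ - hk - x * hsum⟩
    have h₀ : 0 < m := by by_contra!; nlinarith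
    have h₂ : m < 2 := by by_contra!; nlinarith
    obtain rfl : m = 1 := by omega
    linarith
  constructor
  · intro h
    have := Int.le_of_dvd (sub_pos.2 h) (dvd_sub hd₁ hda)
    linarith
  · intro h
    linarith

theorem fraenkel_partition_rational (q p₁ p₂ r₁ r₂ : ℤ)
    (hq : 1 < q) (hp₁ : 0 < p₁) (hp₂ : 0 < p₂) :
    (beattySet p₁ q r₁ ∩ beattySet p₂ q r₂ = ∅ ∧
        beattySet p₁ q r₁ ∪ beattySet p₂ q r₂ = Set.univ) ↔
      (p₁ + p₂ = q ∧ p₁ * r₁ + p₂ * r₂ ≡ -(Int.gcd p₁ q : ℤ) [ZMOD q]) := by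
  have hq₀ : 0 < q := by omega
  rw [partition_iff_xor]
  refine ⟨fun h => ?_, fun ⟨hsum, hmod⟩ => mem_iff_notMem_of_modEq hq₀ hp₁ hp₂ hsum hmod⟩
  have hlt₁ : p₁ < q := by
    obtain ⟨y, hy⟩ := nonempty_beattySet p₂ q r₂
    exact lt_of_beattySet_ne_univ hq₀ hp₁ fun hu => (h y).1 (hu ▸ Set.mem_univ y) hy
  have hlt₂ : p₂ < q := by
    obtain ⟨y, hy⟩ := nonempty_beattySet p₁ q r₁
    exact lt_of_beattySet_ne_univ hq₀ hp₂ fun hu => (h y).1 hy (hu ▸ Set.mem_univ y)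
  have quot := ediv_add_ediv_of_partition hq₀ hp₁ hp₂ hlt₁ hlt₂ h
  have hsum : p₁ + p₂ = q := by
    have hshift (p r : ℤ) : p * (r - q) / q = p * r / q - p := by
      rw [show p * (r - q) = p * r + -p * q by ring, Int.add_mul_ediv_right _ _ hq₀.ne']
      ring
    have := quot q
    rw [hshift, hshift] at this
    linarith
  refine ⟨hsum, ?_⟩
  have rem (x : ℤ) : p₁ * (r₁ - x) % q + p₂ * (r₂ - x) % q =
      p₁ * r₁ + p₂ * r₂ - q * (p₁ * r₁ / q + p₂ * r₂ / q) := by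
    have ediv₁ := Int.emod_add_mul_ediv (p₁ * (r₁ - x)) q
    have ediv₂ := Int.emod_add_mul_ediv (p₂ * (r₂ - x)) q
    linear_combination ediv₁ + ediv₂ - q * quot x - x * hsum
  have hd : (0 : ℤ) < Int.gcd p₁ q := by exact_mod_cast Int.gcd_pos_of_ne_zero_left _ hp₁.ne'
  have hd₁ : (Int.gcd p₁ q : ℤ) ∣ p₁ := Int.gcd_dvd_left ..
  have hdq : (Int.gcd p₁ q : ℤ) ∣ q := Int.gcd_dvd_right ..
  have hd₂ : (Int.gcd p₁ q : ℤ) ∣ p₂ := by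
    simpa [← hsum] using dvd_sub hdq hd₁
  have upper := rem r₁
  have lower := rem (r₁ + Int.gcdA p₁ q)
  have hneg : p₁ * (r₁ - (r₁ + Int.gcdA p₁ q)) % q = q - Int.gcd p₁ q := by
    have hbez := Int.gcd_eq_gcd_ab p₁ q
    rw [show p₁ * (r₁ - (r₁ + Int.gcdA p₁ q)) =
      q - Int.gcd p₁ q + q * (Int.gcdB p₁ q - 1) by linear_combination hbez,
      Int.add_mul_emod_self_left]
    exact Int.emod_eq_of_lt (by linarith [Int.le_of_dvd hq₀ hdq]) (by linarith)
  rw [sub_self, mul_zero, Int.zero_emod] at upper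
  have hle := emod_le_sub_of_dvd hq₀ hdq (hd₂.mul_right (r₂ - r₁))
  have hge := Int.emod_nonneg (p₂ * (r₂ - (r₁ + Int.gcdA p₁ q))) hq₀.ne'
  rw [Int.modEq_iff_dvd]
  exact ⟨-(1 + (p₁ * r₁ / q + p₂ * r₂ / q)), by linarith⟩
end

section
/- (Covering Criterion.) Let q > 1, let p_1, …, p_m be positive integers and r_1, …, r_m be integers, set g_k := gcd(p_k, q), and for each k let p̄_k be an integer with p_k·p̄_k ≡ g_k (mod q). Let c be a positive integer. The Beatty sequences B_{p_k,r_k}^q (1 ≤ k ≤ m) form a perfect c-fold covering of ℤ if and only if both: (1) c·q = ∑_{k=1}^m p_k, and (2) for every integer j with 1 ≤ j < q, 0 = ∑_{k=1}^m [g_k | j]·g_k·ω^{−j·r_k}/(1 − ω^{j·p̄_k}), where [g_k | j] is 1 if g_k divides j and 0 otherwise (and when g_k | j with 1 ≤ j < q one has ω^{j·p̄_k} ≠ 1, so each term is well defined). -/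
open Complex Real

/-- The Beatty multiplicity function `B_{p,r}^q(x) := #{n ∈ ℤ : ⌊nq/p + r⌋ = x}`. -/
noncomputable def beattyCount (p q r x : ℤ) : ℕ :=
  {n : ℤ | ⌊((n : ℚ) * q / p + r)⌋ = x}.ncard

lemma beattyCount_eq_sub_ediv {p N : ℤ} (hp : 0 < p) (hN : 0 < N) (r x : ℤ) :
    (beattyCount p N r x : ℤ) = (-(p * (x - r))) / N - (-(p * (x - r + 1))) / N := by
  have hset : {n : ℤ | ⌊((n : ℚ) * N / p + r)⌋ = x} =
      (Finset.Ico (-((-(p * (x - r))) / N)) (-((-(p * (x - r + 1))) / N)) : Finset ℤ) := by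
    ext n
    have hpQ : (0 : ℚ) < p := by exact_mod_cast hp
    have lower : -((-(p * (x - r))) / N) ≤ n ↔ p * (x - r) ≤ n * N := by
      rw [neg_le, Int.le_ediv_iff_mul_le hN, neg_mul, neg_le_neg_iff]
    have upper : n < -((-(p * (x - r + 1))) / N) ↔ n * N < p * (x - r + 1) := by
      rw [lt_neg, Int.ediv_lt_iff_lt_mul hN, neg_mul, neg_lt_neg_iff]
    rw [Finset.coe_Ico, Set.mem_Ico, lower, upper, Set.mem_ofPred_eq, Int.floor_eq_iff,
      ← sub_le_iff_le_add, le_div_iff₀ hpQ, add_comm ((n : ℚ) * N / p), ← lt_sub_iff_add_lt',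
      div_lt_iff₀ hpQ]
    have e1 : ((x : ℚ) - r) * p = ((p * (x - r) : ℤ) : ℚ) := by push_cast; ring
    have e2 : ((x : ℚ) + 1 - r) * p = ((p * (x - r + 1) : ℤ) : ℚ) := by push_cast; ring
    rw [e1, e2]
    norm_cast
  rw [beattyCount, hset, Set.ncard_coe_finset, Int.card_Ico]
  have : (-(p * (x - r + 1))) / N ≤ (-(p * (x - r))) / N :=
    Int.ediv_le_ediv hN (by nlinarith)
  omega

section

open ZMod

variable {N : ℕ} [NeZero N]

/-- The least nonnegative residue of `-(p * y)` modulo `N`, as a complex-valued function of `y`. -/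
noncomputable def negMulResidue (p : ℤ) (y : ZMod N) : ℂ := ((-((p : ZMod N) * y)).val : ℂ)

lemma negMulResidue_intCast (p y : ℤ) :
    negMulResidue p (y : ZMod N) = (((-(p * y)) % N : ℤ) : ℂ) := by
  have h := ZMod.val_intCast (n := N) (-(p * y))
  rw [← h, negMulResidue]
  push_cast
  rfl

/-- `N` times the Beatty multiplicity function, as a function on `ZMod N`. -/
noncomputable def scaledBeatty (p r : ℤ) (y : ZMod N) : ℂ :=
  p + (negMulResidue p (y + ((1 - r : ℤ) : ZMod N)) -
    negMulResidue p (y + ((-r : ℤ) : ZMod N)))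

lemma mul_beattyCount {p : ℤ} (hp : 0 < p) (r x : ℤ) :
    (N : ℂ) * beattyCount p N r x = scaledBeatty p r (x : ZMod N) := by
  have hN : (0 : ℤ) < N := by exact_mod_cast NeZero.pos N
  have h := beattyCount_eq_sub_ediv hp hN r x
  rw [scaledBeatty, ← Int.cast_add, ← Int.cast_add, negMulResidue_intCast, negMulResidue_intCast,
    ← Int.cast_natCast (beattyCount p N r x), h]
  have e1 := Int.mul_ediv_add_emod (-(p * (x + (1 - r)))) N
  have e2 := Int.mul_ediv_add_emod (-(p * (x + -r))) N
  rw [show x - r + 1 = x + (1 - r) by ring, show x - r = x + -r by ring]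
  norm_cast
  linear_combination e2 - e1

lemma dft_comp_add_right (Φ : ZMod N → ℂ) (a j : ZMod N) :
    𝓕 (fun y => Φ (y + a)) j = stdAddChar (a * j) * 𝓕 Φ j := by
  rw [ZMod.dft_apply, ZMod.dft_apply, Finset.mul_sum]
  refine Fintype.sum_equiv (Equiv.addRight a) _ _ fun y => ?_
  simp only [Equiv.coe_addRight, smul_eq_mul, ← mul_assoc, ← AddChar.map_add_eq_mul]
  ring_nf

lemma dft_const_apply_of_ne_zero (a : ℂ) {j : ZMod N} (hj : j ≠ 0) :
    𝓕 (fun _ : ZMod N => a) j = 0 := by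
  have h := dft_comp_add_right (fun _ : ZMod N => a) 1 j
  rw [one_mul] at h
  have hne : stdAddChar j ≠ (1 : ℂ) := by
    rw [← AddChar.map_zero_eq_one (stdAddChar (N := N))]
    exact fun h => hj (injective_stdAddChar h)
  by_contra h0
  exact hne (mul_right_cancel₀ h0 (by rw [one_mul]; exact h.symm))

lemma val_add_of_dvd {g : ℕ} (hg : 0 < g) (hgN : g ∣ N) {a : ZMod N} (ha : g ∣ a.val) :
    ((a + g).val : ℂ) = a.val + g - N * if a + g = 0 then 1 else 0 := by
  have hlt := ZMod.val_lt a
  have hcast : a + g = ((a.val + g : ℕ) : ZMod N) := by simp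
  have hle : a.val + g ≤ N := by
    obtain ⟨u, hu⟩ := ha
    obtain ⟨v, hv⟩ := hgN
    rw [hu, hv] at hlt
    have := Nat.lt_of_mul_lt_mul_left hlt
    calc a.val + g = g * (u + 1) := by rw [hu]; ring
      _ ≤ g * v := Nat.mul_le_mul_left g this
      _ = N := hv.symm
  rcases hle.lt_or_eq with h | h
  · have hv : (a + g).val = a.val + g := by rw [hcast, ZMod.val_cast_of_lt h]
    have hne : a + g ≠ 0 := by
      intro h0
      rw [h0, ZMod.val_zero] at hv
      omega
    simp [hv, hne]
  · have h0 : a + g = 0 := by rw [hcast, h, ZMod.natCast_self]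
    rw [h0, if_pos rfl, ZMod.val_zero, ← Nat.cast_add, h]
    simp

lemma negMulResidue_add_neg {p pbar : ℤ}
    (h : (p : ZMod N) * (pbar : ZMod N) = (Int.gcd p N : ZMod N)) (y : ZMod N) :
    negMulResidue p (y + -(pbar : ZMod N)) = negMulResidue p y + Int.gcd p N -
      N * if (p : ZMod N) * (y + -(pbar : ZMod N)) = 0 then 1 else 0 := by
  have hgN : Int.gcd p N ∣ N := by exact_mod_cast Int.gcd_dvd_right p (N : ℤ)
  have hg : 0 < Int.gcd p N := Nat.pos_of_dvd_of_pos hgN (NeZero.pos N)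
  have hdvd : Int.gcd p N ∣ (-((p : ZMod N) * y)).val := by
    obtain ⟨z, rfl⟩ := ZMod.intCast_surjective y
    have hz := ZMod.val_intCast (n := N) (-(p * z))
    push_cast at hz
    zify
    rw [hz, EuclideanDomain.dvd_mod_iff (Int.gcd_dvd_right p (N : ℤ)), dvd_neg]
    exact (Int.gcd_dvd_left p (N : ℤ)).mul_right z
  have hrw : -((p : ZMod N) * (y + -(pbar : ZMod N))) =
      -((p : ZMod N) * y) + (Int.gcd p N : ZMod N) := by
    rw [← h]; ring
  have hv := val_add_of_dvd hg hgN hdvd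
  rw [← hrw] at hv
  simpa only [negMulResidue, neg_eq_zero] using hv

/-- The number of solutions of `p * z = 0` in `ZMod N` is `gcd(p, N)`. -/
lemma sum_ite_mul_eq_zero {p pbar : ℤ}
    (h : (p : ZMod N) * (pbar : ZMod N) = (Int.gcd p N : ZMod N)) :
    ∑ z : ZMod N, (if (p : ZMod N) * z = 0 then (1 : ℂ) else 0) = Int.gcd p N := by
  have hs := Fintype.sum_equiv (Equiv.addRight (-pbar : ZMod N))
    (fun y => negMulResidue p (y + -(pbar : ZMod N))) (negMulResidue p) fun y => rfl
  have hi := Fintype.sum_equiv (Equiv.addRight (-pbar : ZMod N))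
    (fun y => if (p : ZMod N) * (y + -(pbar : ZMod N)) = 0 then (1 : ℂ) else 0)
    (fun z => if (p : ZMod N) * z = 0 then (1 : ℂ) else 0) fun y => rfl
  simp only [negMulResidue_add_neg h, Finset.sum_sub_distrib, Finset.sum_add_distrib,
    ← Finset.mul_sum, hi] at hs
  simp only [Finset.sum_const, Finset.card_univ, ZMod.card, nsmul_eq_mul] at hs
  have hN : (N : ℂ) ≠ 0 := by exact_mod_cast NeZero.ne N
  refine mul_left_cancel₀ hN ?_
  linear_combination -hs

lemma dft_negMulResidue_mul {p pbar : ℤ}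
    (h : (p : ZMod N) * (pbar : ZMod N) = (Int.gcd p N : ZMod N)) {j : ℤ} (hj : (j : ZMod N) ≠ 0)
    (hdvd : (Int.gcd p N : ℤ) ∣ j) :
    𝓕 (negMulResidue (N := N) p) j * (1 - stdAddChar ((j : ZMod N) * (pbar : ZMod N))) =
      -(N * Int.gcd p N) := by
  have hind : 𝓕 (fun z : ZMod N => if (p : ZMod N) * z = 0 then (1 : ℂ) else 0) j =
      Int.gcd p N := by
    rw [← sum_ite_mul_eq_zero h, ZMod.dft_apply]
    refine Finset.sum_congr rfl fun z _ => ?_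
    split_ifs with hz
    · obtain ⟨t, rfl⟩ := hdvd
      have : z * ((Int.gcd p N * t : ℤ) : ZMod N) = 0 := by
        push_cast
        rw [← h]
        linear_combination (pbar * t : ZMod N) * hz
      rw [this, neg_zero, AddChar.map_zero_eq_one, one_smul]
    · rw [smul_zero]
  have hshift := dft_comp_add_right (negMulResidue (N := N) p) (-pbar) j
  have hfun : (fun y : ZMod N => negMulResidue p (y + -(pbar : ZMod N))) =
      negMulResidue p + (fun _ => (Int.gcd p N : ℂ)) -
        (N : ℂ) • fun y => if (p : ZMod N) * (y + -(pbar : ZMod N)) = 0 then (1 : ℂ) else 0 :=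
    funext fun y => by simp only [negMulResidue_add_neg h, Pi.add_apply, Pi.sub_apply,
      Pi.smul_apply, smul_eq_mul]
  have hshift' := dft_comp_add_right
    (fun z : ZMod N => if (p : ZMod N) * z = 0 then (1 : ℂ) else 0) (-pbar) j
  rw [hfun, map_sub, map_add, _root_.map_smul, Pi.sub_apply, Pi.add_apply, Pi.smul_apply,
    dft_const_apply_of_ne_zero _ hj, hshift', hind, smul_eq_mul] at hshift
  have hinv : stdAddChar ((j : ZMod N) * (pbar : ZMod N)) *
      stdAddChar (-(pbar : ZMod N) * (j : ZMod N)) = (1 : ℂ) := by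
    rw [← AddChar.map_add_eq_mul, ← AddChar.map_zero_eq_one (stdAddChar (N := N))]
    ring_nf
  linear_combination -(stdAddChar ((j : ZMod N) * (pbar : ZMod N))) * hshift +
    (-(N * Int.gcd p N) - 𝓕 (negMulResidue (N := N) p) j) * hinv

lemma dft_negMulResidue_of_not_dvd {p j : ℤ} (hdvd : ¬ (Int.gcd p N : ℤ) ∣ j) :
    𝓕 (negMulResidue (N := N) p) j = 0 := by
  obtain ⟨d, hd⟩ := Int.gcd_dvd_right p (N : ℤ)
  obtain ⟨s, hs⟩ := Int.gcd_dvd_left p (N : ℤ)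
  have hd0 : d ≠ 0 := by
    rintro rfl
    rw [mul_zero] at hd
    exact NeZero.ne N (by exact_mod_cast hd)
  have hpd : (p : ZMod N) * d = 0 := by
    rw [← Int.cast_mul, ZMod.intCast_zmod_eq_zero_iff_dvd]
    exact ⟨s, by linear_combination d * hs - s * hd⟩
  have hfun : (fun y : ZMod N => negMulResidue p (y + (d : ZMod N))) = negMulResidue p :=
    funext fun y => by simp only [negMulResidue, mul_add, hpd, add_zero]
  have h := dft_comp_add_right (negMulResidue (N := N) p) d j
  rw [hfun] at h
  have hne : stdAddChar ((d : ZMod N) * (j : ZMod N)) ≠ (1 : ℂ) := by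
    rw [← AddChar.map_zero_eq_one (stdAddChar (N := N))]
    intro h0
    have h1 := injective_stdAddChar h0
    rw [← Int.cast_mul, ZMod.intCast_zmod_eq_zero_iff_dvd] at h1
    rw [hd, mul_comm] at h1
    exact hdvd (Int.dvd_of_mul_dvd_mul_left hd0 h1)
  by_contra h0
  exact hne (mul_right_cancel₀ h0 (by rw [one_mul]; exact h.symm))

lemma dft_scaledBeatty_apply (p r : ℤ) (j : ZMod N) :
    𝓕 (scaledBeatty p r) j = 𝓕 (fun _ : ZMod N => (p : ℂ)) j +
      (stdAddChar (((1 - r : ℤ) : ZMod N) * j) * 𝓕 (negMulResidue p) j -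
        stdAddChar (((-r : ℤ) : ZMod N) * j) * 𝓕 (negMulResidue p) j) := by
  rw [← dft_comp_add_right, ← dft_comp_add_right, ← Pi.sub_apply, ← Pi.add_apply, ← map_sub,
    ← map_add]
  rfl

lemma dft_scaledBeatty_zero (p r : ℤ) : 𝓕 (scaledBeatty (N := N) p r) 0 = N * p := by
  rw [dft_scaledBeatty_apply, ZMod.dft_apply_zero]
  simp

lemma dft_scaledBeatty {p pbar : ℤ} (r : ℤ)
    (h : (p : ZMod N) * (pbar : ZMod N) = (Int.gcd p N : ZMod N)) {j : ℤ} (hj : (j : ZMod N) ≠ 0) :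
    𝓕 (scaledBeatty (N := N) p r) j = N * (1 - stdAddChar (j : ZMod N)) *
      if (Int.gcd p N : ℤ) ∣ j then
        (Int.gcd p N : ℂ) * stdAddChar ((-(j * r) : ℤ) : ZMod N) /
          (1 - stdAddChar ((j * pbar : ℤ) : ZMod N))
      else 0 := by
  rw [dft_scaledBeatty_apply, dft_const_apply_of_ne_zero _ hj]
  split_ifs with hdvd
  · have hT := dft_negMulResidue_mul h hj hdvd
    have hgN : Int.gcd p N ∣ N := by exact_mod_cast Int.gcd_dvd_right p (N : ℤ)
    have hg : Int.gcd p N ≠ 0 := (Nat.pos_of_dvd_of_pos hgN (NeZero.pos N)).ne'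
    rw [← Int.cast_mul] at hT
    have hne : (1 : ℂ) - stdAddChar ((j * pbar : ℤ) : ZMod N) ≠ 0 := by
      intro h0
      rw [h0, mul_zero, zero_eq_neg] at hT
      exact mul_ne_zero (by exact_mod_cast NeZero.ne N) (by exact_mod_cast hg) hT
    have e1 : ((1 - r : ℤ) : ZMod N) * j = j + ((-(j * r) : ℤ) : ZMod N) := by push_cast; ring
    have e2 : ((-r : ℤ) : ZMod N) * j = ((-(j * r) : ℤ) : ZMod N) := by push_cast; ring
    rw [e1, e2, AddChar.map_add_eq_mul, mul_div_assoc', eq_div_iff hne]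
    linear_combination (stdAddChar (j : ZMod N) - 1) *
      stdAddChar ((-(j * r) : ℤ) : ZMod N) * hT
  · rw [dft_negMulResidue_of_not_dvd hdvd]
    simp

lemma exp_zpow_eq_stdAddChar (n : ℤ) :
    Complex.exp (2 * Real.pi * Complex.I / (N : ℤ)) ^ n = stdAddChar (n : ZMod N) := by
  rw [stdAddChar_coe, ← Complex.exp_int_mul]
  congr 1
  push_cast
  ring

end

theorem covering_criterion (q : ℤ) (hq : 1 < q) (m : ℕ)
    (p r pbar : Fin m → ℤ) (hp : ∀ k, 0 < p k)
    (hpbar : ∀ k, p k * pbar k ≡ (Int.gcd (p k) q : ℤ) [ZMOD q])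
    (c : ℕ) (hc : 0 < c) :
    (∀ x : ℤ, ∑ k, beattyCount (p k) q (r k) x = c) ↔
      ((c : ℤ) * q = ∑ k, p k ∧
        ∀ j : ℤ, 1 ≤ j → j < q →
          (0 : ℂ) = ∑ k, if (Int.gcd (p k) q : ℤ) ∣ j then
              (Int.gcd (p k) q : ℂ) *
                Complex.exp (2 * Real.pi * Complex.I / q) ^ (-(j * r k)) /
                (1 - Complex.exp (2 * Real.pi * Complex.I / q) ^ (j * pbar k))
            else 0) := by
  lift q to ℕ using by omega with N
  have : NeZero N := ⟨by rintro rfl; simp at hq⟩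
  have hN : (N : ℂ) ≠ 0 := by exact_mod_cast NeZero.ne N
  have hbar (k) : (p k : ZMod N) * pbar k = (Int.gcd (p k) N : ZMod N) := by
    have := (ZMod.intCast_eq_intCast_iff _ _ N).2 (hpbar k)
    push_cast at this
    exact this
  have hcount : (∀ x : ℤ, ∑ k, beattyCount (p k) N (r k) x = c) ↔
      ∑ k, scaledBeatty (N := N) (p k) (r k) = fun _ => (N * c : ℂ) := by
    rw [funext_iff, (ZMod.intCast_surjective (n := N)).forall]
    refine forall_congr' fun x => ?_
    simp only [Finset.sum_apply, ← mul_beattyCount (hp _), ← Finset.mul_sum]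
    rw [mul_right_inj' hN]
    norm_cast
  rw [hcount, ← (ZMod.dft (N := N) (E := ℂ)).injective.eq_iff, funext_iff, map_sum]
  simp only [exp_zpow_eq_stdAddChar, Finset.sum_apply]
  have hzero : ∑ k, ZMod.dft (scaledBeatty (N := N) (p k) (r k)) 0 =
      ZMod.dft (fun _ : ZMod N => (N * c : ℂ)) 0 ↔ (c : ℤ) * N = ∑ k, p k := by
    simp only [dft_scaledBeatty_zero, ← Finset.mul_sum]
    rw [ZMod.dft_apply_zero, Finset.sum_const, Finset.card_univ, ZMod.card, nsmul_eq_mul,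
      mul_right_inj' hN, eq_comm, mul_comm (N : ℂ)]
    norm_cast
  have hne {j : ℤ} (hj : (j : ZMod N) ≠ 0) :
      ∑ k, ZMod.dft (scaledBeatty (N := N) (p k) (r k)) j =
        ZMod.dft (fun _ : ZMod N => (N * c : ℂ)) j ↔
      (0 : ℂ) = ∑ k, if (Int.gcd (p k) N : ℤ) ∣ j then
          (Int.gcd (p k) N : ℂ) * ZMod.stdAddChar ((-(j * r k) : ℤ) : ZMod N) /
            (1 - ZMod.stdAddChar ((j * pbar k : ℤ) : ZMod N))
        else 0 := by
    have hχ : (1 : ℂ) - ZMod.stdAddChar (j : ZMod N) ≠ 0 := by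
      rw [← AddChar.map_zero_eq_one (ZMod.stdAddChar (N := N)), sub_ne_zero]
      exact fun h => hj (ZMod.injective_stdAddChar h).symm
    simp only [dft_scaledBeatty _ (hbar _) hj, ← Finset.mul_sum]
    rw [dft_const_apply_of_ne_zero _ hj, mul_eq_zero, or_iff_right (mul_ne_zero hN hχ), eq_comm]
  constructor
  · intro h
    refine ⟨hzero.1 (h 0), fun j hj1 hj2 => (hne ?_).1 (h j)⟩
    rw [Ne, ZMod.intCast_zmod_eq_zero_iff_dvd]
    exact fun hd => absurd (Int.le_of_dvd (by omega) hd) (by omega)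
  · rintro ⟨h0, h1⟩ j
    by_cases hj : j = 0
    · rw [hj]
      exact hzero.2 h0
    · have hcast : ((j.val : ℤ) : ZMod N) = j := by simp
      have hpos : j.val ≠ 0 := (ZMod.val_ne_zero j).2 hj
      rw [← hcast] at hj ⊢
      exact (hne hj).2 (h1 _ (by omega) (by exact_mod_cast ZMod.val_lt j))
end

section
/- For all integers p > 0, q > 0 and every x ∈ ℤ, the number of integers n with ⌊nq/(p+q)⌋ = x equals 1 plus the number of integers n with ⌊nq/p⌋ = x. In other words, B_{p+q}^q(x) = 1 + B_p^q(x) for every integer x. -/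
/-- With zero shift, the fibre over `x` is an integer interval between two ceilings. -/
theorem beattyCount_zero_eq_toNat (p q : ℤ) (hp : 0 < p) (hq : 0 < q) (x : ℤ) :
    beattyCount p q 0 x =
      (⌈((x + 1 : ℤ) : ℚ) * p / q⌉ - ⌈(x : ℚ) * p / q⌉).toNat := by
  have hp' : (0 : ℚ) < p := by exact_mod_cast hp
  have hq' : (0 : ℚ) < q := by exact_mod_cast hq
  have h : {n : ℤ | ⌊((n : ℚ) * q / p + (0 : ℤ))⌋ = x} =
      (Finset.Ico ⌈(x : ℚ) * p / q⌉ ⌈((x + 1 : ℤ) : ℚ) * p / q⌉ : Finset ℤ) := by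
    ext n
    rw [Set.mem_ofPred_eq, Finset.coe_Ico, Set.mem_Ico, Int.floor_eq_iff, Int.ceil_le,
      Int.lt_ceil, Int.cast_zero, add_zero, le_div_iff₀ hp', div_lt_iff₀ hp',
      div_le_iff₀ hq', lt_div_iff₀ hq', Int.cast_add, Int.cast_one]
  rw [beattyCount, h, Set.ncard_coe_finset, Int.card_Ico]

theorem beattyCount_add_q (p q : ℤ) (hp : 0 < p) (hq : 0 < q) (x : ℤ) :
    beattyCount (p + q) q 0 x = 1 + beattyCount p q 0 x := by
  have hp' : (0 : ℚ) < p := by exact_mod_cast hp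
  have hq' : (0 : ℚ) < q := by exact_mod_cast hq
  have ceil_add (y : ℤ) : ⌈(y : ℚ) * (p + q : ℤ) / q⌉ = ⌈(y : ℚ) * p / q⌉ + y := by
    rw [← Int.ceil_add_intCast]
    congr 1
    push_cast
    field_simp
  have mono : ⌈(x : ℚ) * p / q⌉ ≤ ⌈((x + 1 : ℤ) : ℚ) * p / q⌉ := by
    gcongr
    omega
  rw [beattyCount_zero_eq_toNat _ _ (by omega) hq, beattyCount_zero_eq_toNat _ _ hp hq,
    ceil_add, ceil_add]
  omega
end

section
/- (Duality.) Let p, q be relatively prime integers with 0 < p < q. An integer k belongs to the Beatty set B_p^q if and only if the fractional part of kp/q is 0 or is strictly greater than 1 − p/q. -/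
/-- A half-open interval `[x, x + y)` of positive length contains an integer iff `x` is an
integer or the fractional part of `x` exceeds `1 - y`. -/
theorem exists_int_mem_Ico_iff_fract {x y : ℚ} (hy : 0 < y) :
    (∃ n : ℤ, x ≤ n ∧ (n : ℚ) < x + y) ↔ (Int.fract x = 0 ∨ 1 - y < Int.fract x) := by
  have hx : (⌊x⌋ : ℚ) + Int.fract x = x := Int.floor_add_fract x
  have h0 := Int.fract_nonneg x
  have h1 := Int.fract_lt_one x
  constructor
  · rintro ⟨n, hn, hn'⟩
    rcases le_or_gt n ⌊x⌋ with h | h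
    · have : (n : ℚ) ≤ ⌊x⌋ := by exact_mod_cast h
      left; linarith
    · have : (⌊x⌋ : ℚ) + 1 ≤ n := by exact_mod_cast h
      right; linarith
  · rintro (h | h)
    · exact ⟨⌊x⌋, by linarith, by linarith⟩
    · exact ⟨⌊x⌋ + 1, by push_cast; linarith, by push_cast; linarith⟩

theorem mem_beattySet_zero_iff {p q : ℤ} (hp : 0 < p) (hq : 0 < q) (k : ℤ) :
    k ∈ beattySet p q 0 ↔
      ∃ n : ℤ, (k : ℚ) * p / q ≤ n ∧ (n : ℚ) < (k : ℚ) * p / q + (p : ℚ) / q := by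
  have hp' : (0 : ℚ) < p := by exact_mod_cast hp
  have hq' : (0 : ℚ) < q := by exact_mod_cast hq
  refine exists_congr fun n => ?_
  rw [Int.floor_eq_iff, Int.cast_zero, add_zero, le_div_iff₀ hp', div_lt_iff₀ hp',
    ← add_div, div_le_iff₀ hq', lt_div_iff₀ hq', add_mul, one_mul]

theorem beatty_duality (p q : ℤ) (hp : 0 < p) (hpq : p < q) (hcop : Int.gcd p q = 1)
    (k : ℤ) :
    k ∈ beattySet p q 0 ↔
      (Int.fract ((k : ℚ) * p / q) = 0 ∨ 1 - (p : ℚ) / q < Int.fract ((k : ℚ) * p / q)) := by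
  have hq : 0 < q := hp.trans hpq
  have hp' : (0 : ℚ) < p := by exact_mod_cast hp
  have hq' : (0 : ℚ) < q := by exact_mod_cast hq
  rw [mem_beattySet_zero_iff hp hq,
    exists_int_mem_Ico_iff_fract (div_pos hp' hq')]
end

section
/- Let p, q be relatively prime integers with 0 < p < q, and let p̄ be the integer with 0 < p̄ < q and p·p̄ ≡ 1 (mod q). Then for every integer x, the number of elements of the Beatty set B_p^q in the interval [x, x + p̄) equals ⌊p̄·p/q⌋ + 1 if q divides x, and equals ⌊p̄·p/q⌋ otherwise. -/
theorem beattySet_zero_eq_range (p q : ℤ) (hp : 0 < p) :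
    beattySet p q 0 = Set.range fun n : ℤ => n * q / p := by
  ext k
  have hfloor (n : ℤ) : ⌊((n : ℚ) * q / p + (0 : ℤ))⌋ = n * q / p := by
    rw [Int.cast_zero, add_zero, ← Int.cast_mul, Int.floor_div_cast_of_nonneg hp.le,
      Int.floor_intCast]
  simp only [beattySet, Set.mem_ofPred_eq, Set.mem_range, hfloor]

theorem mul_ediv_injective {p q : ℤ} (hp : 0 < p) (hpq : p ≤ q) :
    Function.Injective fun n : ℤ => n * q / p := by
  apply StrictMono.injective
  apply strictMono_int_of_lt_succ
  intro n
  calc n * q / p < n * q / p + 1 := lt_add_one _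
    _ = (n * q + p) / p := by rw [Int.add_ediv_of_dvd_right dvd_rfl, Int.ediv_self hp.ne']
    _ ≤ (n + 1) * q / p := Int.ediv_le_ediv hp (by linarith)

/-- Counting a homogeneous Beatty set in `[x, y)` amounts to counting the multiples of `q`
in `[x * p, y * p)`. -/
theorem ncard_beattySet_Ico {p q x y a b : ℤ} (hp : 0 < p) (hpq : p ≤ q) (hab : a ≤ b)
    (ha : ∀ n, x * p ≤ n * q ↔ a ≤ n) (hb : ∀ n, n * q < y * p ↔ n < b) :
    ({k : ℤ | k ∈ beattySet p q 0 ∧ x ≤ k ∧ k < y}.ncard : ℤ) = b - a := by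
  have himage : {k : ℤ | k ∈ beattySet p q 0 ∧ x ≤ k ∧ k < y} =
      (fun n : ℤ => n * q / p) '' (Finset.Ico a b : Finset ℤ) := by
    ext k
    rw [beattySet_zero_eq_range p q hp]
    simp only [Set.mem_ofPred_eq, Set.mem_range, Set.mem_image, Finset.coe_Ico, Set.mem_Ico]
    constructor
    · rintro ⟨⟨n, rfl⟩, hx, hy⟩
      exact ⟨n, ⟨(ha n).1 ((Int.le_ediv_iff_mul_le hp).1 hx),
        (hb n).1 ((Int.ediv_lt_iff_lt_mul hp).1 hy)⟩, rfl⟩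
    · rintro ⟨n, ⟨hx, hy⟩, rfl⟩
      exact ⟨⟨n, rfl⟩, (Int.le_ediv_iff_mul_le hp).2 ((ha n).2 hx),
        (Int.ediv_lt_iff_lt_mul hp).2 ((hb n).2 hy)⟩
  rw [himage, Set.ncard_image_of_injective _ (mul_ediv_injective hp hpq),
    Set.ncard_coe_finset, Int.card_Ico, Int.toNat_of_nonneg (sub_nonneg.2 hab)]

theorem beatty_count_interval (p q pbar : ℤ) (hp : 0 < p) (hpq : p < q)
    (hcop : Int.gcd p q = 1) (hpbar_pos : 0 < pbar) (hpbar_lt : pbar < q)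
    (hpbar : p * pbar ≡ 1 [ZMOD q]) (x : ℤ) :
    ((q ∣ x →
        ({k : ℤ | k ∈ beattySet p q 0 ∧ x ≤ k ∧ k < x + pbar}.ncard : ℤ)
          = ⌊(pbar : ℚ) * p / q⌋ + 1) ∧
      (¬ q ∣ x →
        ({k : ℤ | k ∈ beattySet p q 0 ∧ x ≤ k ∧ k < x + pbar}.ncard : ℤ)
          = ⌊(pbar : ℚ) * p / q⌋)) := by
  have hq : 0 < q := hp.trans hpq
  obtain ⟨m, hm⟩ := hpbar.symm.dvd
  have hmul : pbar * p = 1 + q * m := by linarith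
  have hm0 : 0 ≤ m := by
    by_contra! h
    nlinarith [mul_pos hpbar_pos hp]
  have hfloor : ⌊(pbar : ℚ) * p / q⌋ = m := by
    have hq' : (0 : ℚ) < q := by exact_mod_cast hq
    rw [Int.floor_eq_iff, le_div_iff₀ hq', div_lt_iff₀ hq']
    norm_cast
    constructor <;> nlinarith
  rw [hfloor]
  constructor
  · rintro ⟨c, rfl⟩
    rw [ncard_beattySet_Ico (a := c * p) (b := c * p + m + 1) hp hpq.le (by linarith)]
    · ring
    · intro n
      rw [show q * c * p = c * p * q by ring, mul_le_mul_iff_left₀ hq]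
    · intro n
      rw [show (q * c + pbar) * p = (c * p + m) * q + 1 by linear_combination hmul,
        Int.lt_add_one_iff, mul_le_mul_iff_left₀ hq, Int.lt_add_one_iff]
  · intro hx
    have hmod : x * p % q ≠ 0 := fun h =>
      hx ((Int.isCoprime_iff_gcd_eq_one.2 hcop).symm.dvd_of_dvd_mul_right
        (Int.dvd_of_emod_eq_zero h))
    have hr0 : 0 < x * p % q := (Int.emod_nonneg _ hq.ne').lt_of_ne' hmod
    have hrq := Int.emod_lt_of_pos (x * p) hq
    have hdiv := Int.mul_ediv_add_emod (x * p) q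
    generalize x * p % q = r at hr0 hrq hdiv
    generalize x * p / q = c at hdiv
    rw [ncard_beattySet_Ico (a := c + 1) (b := c + 1 + m) hp hpq.le (by linarith)]
    · ring
    · intro n
      constructor <;> intro h
      · by_contra! hn
        nlinarith
      · nlinarith
    · intro n
      rw [add_mul, hmul]
      constructor <;> intro h
      · by_contra! hn
        nlinarith
      · nlinarith [mul_nonneg hq.le (show 0 ≤ c + m - n by linarith)]
end

section
/- Let p, q be relatively prime integers with 0 < p < q, and let q̄ be the integer with 0 < q̄ ≤ p and q·q̄ ≡ 1 (mod p). Then for every integer n: if p divides n, then ⌊nq/p⌋ − ⌊(n − q̄)q/p⌋ = ⌈q̄·q/p⌉, and if p does not divide n, then ⌊nq/p⌋ − ⌊(n − q̄)q/p⌋ = ⌊q̄·q/p⌋. -/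
theorem beatty_delta (p q qbar : ℤ) (hp : 0 < p) (hpq : p < q)
    (hcop : Int.gcd p q = 1) (hqbar_pos : 0 < qbar) (hqbar_le : qbar ≤ p)
    (hqbar : q * qbar ≡ 1 [ZMOD p]) (n : ℤ) :
    (p ∣ n → ⌊((n : ℚ) * q / p)⌋ - ⌊(((n : ℚ) - qbar) * q / p)⌋ = ⌈(qbar : ℚ) * q / p⌉) ∧
    (¬ p ∣ n → ⌊((n : ℚ) * q / p)⌋ - ⌊(((n : ℚ) - qbar) * q / p)⌋ = ⌊(qbar : ℚ) * q / p⌋) := by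
  have hpQ : (0 : ℚ) < p := by exact_mod_cast hp
  have floor_div (a m : ℤ) (h₁ : m * p ≤ a) (h₂ : a < (m + 1) * p) : ⌊(a : ℚ) / p⌋ = m := by
    rw [Int.floor_eq_iff, le_div_iff₀ hpQ, div_lt_iff₀ hpQ]
    exact_mod_cast And.intro h₁ h₂
  have ceil_div (a m : ℤ) (h₁ : (m - 1) * p < a) (h₂ : a ≤ m * p) : ⌈(a : ℚ) / p⌉ = m := by
    rw [Int.ceil_eq_iff, lt_div_iff₀ hpQ, div_le_iff₀ hpQ]
    exact_mod_cast And.intro h₁ h₂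
  obtain ⟨k, hk⟩ := hqbar.symm.dvd
  have cast_sub_mul : ((n : ℚ) - qbar) * q = ((n - qbar) * q : ℤ) := by push_cast; ring
  rw [cast_sub_mul, ← Int.cast_mul, ← Int.cast_mul]
  constructor
  · rintro ⟨m, rfl⟩
    rw [floor_div (p * m * q) (m * q) (by linarith) (by linarith),
      floor_div _ (m * q - k - 1) (by linarith) (by linarith),
      ceil_div _ (k + 1) (by linarith) (by linarith)]
    ring
  · intro hn
    have hr : n * q % p ≠ 0 := fun h =>
      hn (Int.dvd_of_dvd_mul_left_of_gcd_one (Int.dvd_of_emod_eq_zero h) hcop)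
    have hr_pos : 1 ≤ n * q % p := (Int.emod_nonneg _ hp.ne').lt_of_ne' hr
    have hr_lt := Int.emod_lt_of_pos (n * q) hp
    have hdiv := Int.mul_ediv_add_emod (n * q) p
    rw [floor_div (n * q) (n * q / p) (by linarith) (by linarith),
      floor_div _ (n * q / p - k) (by linarith) (by linarith),
      floor_div _ k (by linarith) (by linarith)]
    ring
end

section
/- Let q ≥ 3 and m ≥ 1 be integers with 2^m ≡ 1 (mod q). Let p_1, …, p_m be positive integers with p_k ≡ 2^{m−k} (mod q) for each k, and let r_1, …, r_m be integers with r_k ≡ −2^{k−1} (mod q) for each k. Then the Beatty sequences B_{p_k,r_k}^q (1 ≤ k ≤ m) form a perfect covering of ℤ. -/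
theorem setOf_floor_mul_div_add_eq (p q r x : ℤ) (hp : 0 < p) (hq : 0 < q) :
    {n : ℤ | ⌊((n : ℚ) * q / p + r)⌋ = x} =
      Finset.Ico (-(-(p * (x - r)) / q)) (-(-(p * (x - r + 1)) / q)) := by
  ext n
  have hp' : (0 : ℚ) < p := by exact_mod_cast hp
  have hfloor : ⌊((n : ℚ) * q / p + r)⌋ = x ↔
      p * (x - r) ≤ n * q ∧ n * q < p * (x - r + 1) := by
    rw [Int.floor_add_intCast, ← eq_sub_iff_add_eq, Int.floor_eq_iff, le_div_iff₀ hp',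
      div_lt_iff₀ hp', mul_comm p, mul_comm p]
    norm_cast
  have hle : -(-(p * (x - r)) / q) ≤ n ↔ p * (x - r) ≤ n * q := by
    rw [neg_le, Int.le_ediv_iff_mul_le hq, neg_mul, neg_le_neg_iff]
  have hlt : n < -(-(p * (x - r + 1)) / q) ↔ n * q < p * (x - r + 1) := by
    rw [lt_neg, Int.ediv_lt_iff_lt_mul hq, neg_mul, neg_lt_neg_iff]
  rw [Set.mem_ofPred_eq, hfloor, Finset.mem_coe, Finset.mem_Ico, hle, hlt]

theorem beattyCount_mul (p q r x : ℤ) (hp : 0 < p) (hq : 0 < q) :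
    (beattyCount p q r x : ℤ) * q =
      p + (-(p * (x - r + 1)) % q - -(p * (x - r)) % q) := by
  have hmono : -(p * (x - r + 1)) / q ≤ -(p * (x - r)) / q :=
    Int.ediv_le_ediv hq (by linarith)
  rw [beattyCount, setOf_floor_mul_div_add_eq p q r x hp hq, Set.ncard_coe_finset, Int.card_Ico,
    Int.toNat_of_nonneg (by linarith)]
  linear_combination Int.mul_ediv_add_emod (-(p * (x - r))) q -
    Int.mul_ediv_add_emod (-(p * (x - r + 1))) q

theorem neg_add_emod_of_two_mul_modEq_one (q h t : ℤ) (hq : 2 ≤ q) (hh : 2 * h ≡ 1 [ZMOD q]) :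
    2 * (-(t + h) % q) = 2 * (-(2 * t) % q - -t % q) + (q - 1) := by
  obtain ⟨d, hd⟩ := hh.dvd
  have hq0 : q ≠ 0 := by lia
  have e₁ := Int.mul_ediv_add_emod (-(t + h)) q
  have e₂ := Int.mul_ediv_add_emod (-(2 * t)) q
  have e₃ := Int.mul_ediv_add_emod (-t) q
  have l₁ := Int.emod_nonneg (-(t + h)) hq0
  have l₂ := Int.emod_nonneg (-(2 * t)) hq0
  have l₃ := Int.emod_nonneg (-t) hq0
  have u₁ := Int.emod_lt_of_pos (-(t + h)) (by lia : 0 < q)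
  have u₂ := Int.emod_lt_of_pos (-(2 * t)) (by lia : 0 < q)
  have u₃ := Int.emod_lt_of_pos (-t) (by lia : 0 < q)
  generalize -(t + h) % q = A at *
  generalize -(2 * t) % q = B at *
  generalize -t % q = C at *
  generalize -(t + h) / q = a at *
  generalize -(2 * t) / q = b at *
  generalize -t / q = c at *
  have hB : B = 2 * C + q * (2 * c - b) := by linear_combination e₂ - 2 * e₃
  have hA : 2 * A = 2 * C - 1 + q * (2 * c - 2 * a + d) := by
    linear_combination 2 * e₁ - 2 * e₃ + hd
  have hu : -2 < 2 * c - b := by nlinarith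
  have hu' : 2 * c - b < 1 := by nlinarith
  have hv : -2 < 2 * c - 2 * a + d := by nlinarith
  have hv' : 2 * c - 2 * a + d < 2 := by
    by_contra! hcon
    nlinarith
  have hd_odd : d % 2 = 1 := by
    by_contra hd2
    obtain ⟨e, rfl⟩ : ∃ e, d = 2 * e := ⟨d / 2, by lia⟩
    have : 2 * (q * e + h) = 1 := by linear_combination -hd
    lia
  generalize hw : 2 * c - 2 * a + d = w at *
  generalize 2 * c - b = u at *
  have hw' : w = -1 ∨ w = 1 := by lia
  have hu'' : u = -1 ∨ u = 0 := by lia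
  rcases hw' with rfl | rfl <;> rcases hu'' with rfl | rfl <;> lia

theorem two_mul_sum_range_neg_add_emod (q h x : ℤ) (m : ℕ) (hq : 2 ≤ q)
    (hh : 2 * h ≡ 1 [ZMOD q]) (h2m : (2 : ℤ) ^ m ≡ 1 [ZMOD q]) :
    2 * ∑ j ∈ Finset.range m, (-(2 ^ j * x + h) % q) = m * (q - 1) := by
  have hend : -(2 ^ m * x) % q = -x % q := by
    simpa only [one_mul] using (h2m.mul_right x).neg.eq
  have htel := Finset.sum_range_sub (fun j : ℕ ↦ -((2 : ℤ) ^ j * x) % q) m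
  rw [Finset.mul_sum, Finset.sum_congr rfl fun j _ ↦
    neg_add_emod_of_two_mul_modEq_one q h (2 ^ j * x) hq hh]
  simp only [← mul_assoc, ← pow_succ'] at htel ⊢
  rw [Finset.sum_add_distrib, ← Finset.mul_sum, htel, hend]
  simp [mul_sub]

/-- Here the index `k : Fin m` corresponds to `k+1 ∈ {1, …, m}` in the usual
formulation: `p_k ≡ 2^{m-k} (mod q)` becomes `p k ≡ 2^(m-1-k)` and
`r_k ≡ -2^{k-1} (mod q)` becomes `r k ≡ -2^k`. -/
theorem construction_perfect_covering (q : ℤ) (hq : 3 ≤ q) (m : ℕ) (hm : 1 ≤ m)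
    (h2m : (2 : ℤ) ^ m ≡ 1 [ZMOD q])
    (p r : Fin m → ℤ) (hp : ∀ k, 0 < p k)
    (hpk : ∀ k : Fin m, p k ≡ 2 ^ (m - 1 - (k : ℕ)) [ZMOD q])
    (hrk : ∀ k : Fin m, r k ≡ -(2 ^ (k : ℕ)) [ZMOD q]) :
    ∃ c : ℕ, 0 < c ∧ ∀ x : ℤ, ∑ k, beattyCount (p k) q (r k) x = c := by
  have hq0 : 0 < q := by lia
  have hh : 2 * 2 ^ (m - 1) ≡ 1 [ZMOD q] := by
    rwa [← pow_succ', Nat.sub_add_cancel hm]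
  have hmod (k : Fin m) (x y : ℤ) (hy : y = x - r k) :
      -(p k * y) % q = -(2 ^ (m - 1 - (k : ℕ)) * x + 2 ^ (m - 1)) % q := by
    have hpow : (2 : ℤ) ^ (m - 1 - (k : ℕ)) * 2 ^ (k : ℕ) = 2 ^ (m - 1) := by
      rw [← pow_add]
      congr 1
      lia
    rw [hy]
    refine (((hpk k).mul ((Int.ModEq.refl x).sub (hrk k))).neg).trans ?_
    rw [← hpow]
    ring_nf
    rfl
  have key (x : ℤ) : ((∑ k, beattyCount (p k) q (r k) x : ℕ) : ℤ) * q = ∑ k, p k := by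
    have hterm (k : Fin m) : (beattyCount (p k) q (r k) x : ℤ) * q = p k +
        (-(2 ^ (m - 1 - (k : ℕ)) * (x + 1) + 2 ^ (m - 1)) % q -
          -(2 ^ (m - 1 - (k : ℕ)) * x + 2 ^ (m - 1)) % q) := by
      rw [beattyCount_mul _ _ _ _ (hp k) hq0, hmod k (x + 1) _ (by ring), hmod k x _ rfl]
    have hsum (x : ℤ) : ∑ k : Fin m, -(2 ^ (m - 1 - (k : ℕ)) * x + 2 ^ (m - 1)) % q =
        ∑ j ∈ Finset.range m, -(2 ^ j * x + 2 ^ (m - 1)) % q := by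
      rw [Fin.sum_univ_eq_sum_range (fun j ↦ -(2 ^ (m - 1 - j) * x + 2 ^ (m - 1)) % q) m,
        Finset.sum_range_reflect (fun j ↦ -(2 ^ j * x + 2 ^ (m - 1)) % q) m]
    have h₀ := two_mul_sum_range_neg_add_emod q _ x m (by lia) hh h2m
    have h₁ := two_mul_sum_range_neg_add_emod q _ (x + 1) m (by lia) hh h2m
    rw [Nat.cast_sum, Finset.sum_mul, Finset.sum_congr rfl fun k _ ↦ hterm k,
      Finset.sum_add_distrib, Finset.sum_sub_distrib, hsum, hsum]
    lia
  refine ⟨∑ k, beattyCount (p k) q (r k) 0, ?_, fun x ↦ ?_⟩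
  · have hpos : 0 < ∑ k, p k :=
      Finset.sum_pos (fun k _ ↦ hp k) ⟨⟨0, hm⟩, Finset.mem_univ _⟩
    rw [← key 0] at hpos
    exact_mod_cast pos_of_mul_pos_left hpos hq0.le
  · exact_mod_cast mul_right_cancel₀ hq0.ne' ((key x).trans (key 0).symm)
end

section
/- Let q ≥ 3 be odd and let m ≥ 3 be the multiplicative order of 2 modulo q. Let δ be an integer with 0 < δ < q and gcd(δ, q) = 1, let δ̄ be an integer with δ·δ̄ ≡ 1 (mod q), and let γ be any integer. Let p_1, …, p_m be integers with 0 < p_k < q and p_k ≡ δ·2^{m−k} (mod q), and let r_1, …, r_m be integers with r_k ≡ γ − δ̄·2^{k−1} (mod q). Then the Beatty sequences B_{p_k,r_k}^q (1 ≤ k ≤ m) form a perfect c-fold covering of ℤ, where c is the number of ones in the binary expansion of the integer δ·(2^m − 1)/q. -/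
theorem count_one_digits_two_mul_add (n e : ℕ) (he : e < 2) :
    (Nat.digits 2 (2 * n + e)).count 1 = (Nat.digits 2 n).count 1 + e := by
  by_cases h0 : 2 * n + e = 0
  · obtain rfl : n = 0 := by omega
    obtain rfl : e = 0 := by omega
    simp
  · rw [Nat.digits_def' (by norm_num) (by omega), show (2 * n + e) % 2 = e by omega,
      show (2 * n + e) / 2 = n by omega, List.count_cons]
    interval_cases e <;> simp

theorem beattyCount_mul_eq {p q : ℤ} (hp : 0 < p) (hpq : p < q) (r x : ℤ) :
    (beattyCount p q r x : ℤ) * q =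
      (-(p * (x - r)) - p) % q - (-(p * (x - r))) % q + p := by
  have hq : 0 < q := hp.trans hpq
  have hset : {n : ℤ | ⌊((n : ℚ) * q / p + r)⌋ = x} =
      {n : ℤ | p * (x - r) ≤ n * q ∧ n * q < p * (x - r) + p} := by
    ext n
    have hp' : (0 : ℚ) < p := by exact_mod_cast hp
    simp only [Set.mem_ofPred_eq, Int.floor_eq_iff, ← sub_le_iff_le_add,
      ← lt_sub_iff_add_lt, le_div_iff₀ hp', div_lt_iff₀ hp']
    refine and_congr ?_ ?_
    · rw [mul_comm p]
      exact_mod_cast Iff.rfl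
    · rw [show p * (x - r) + p = (x + 1 - r) * p by ring]
      exact_mod_cast Iff.rfl
  rw [beattyCount, hset]
  set y := p * (x - r)
  have h0 := Int.emod_nonneg (-y) hq.ne'
  have h1 := Int.emod_lt_of_pos (-y) hq
  have h2 := Int.emod_add_mul_ediv (-y) q
  set j := (-y) % q
  set t := (-y) / q
  have key : (-y - p) % q = (j - p) % q := by
    rw [← h2, show j + q * t - p = j - p + q * t by ring, Int.add_mul_emod_self_left]
  rw [key]
  by_cases hj : j < p
  · have hs : {n : ℤ | y ≤ n * q ∧ n * q < y + p} = {-t} := by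
      ext n
      simp only [Set.mem_ofPred_eq, Set.mem_singleton_iff]
      constructor
      · rintro ⟨ha, hb⟩
        have hc : (n + t) * q < 1 * q := by linarith
        have hd : (-1) * q < (n + t) * q := by linarith
        have := lt_of_mul_lt_mul_right hc hq.le
        have := lt_of_mul_lt_mul_right hd hq.le
        omega
      · rintro rfl
        constructor <;> linarith
    rw [hs, Set.ncard_singleton, ← Int.add_emod_right, Int.emod_eq_of_lt (by omega) (by omega)]
    push_cast
    ring
  · have hs : {n : ℤ | y ≤ n * q ∧ n * q < y + p} = ∅ := by
      ext n
      simp only [Set.mem_ofPred_eq, Set.mem_empty_iff_false, iff_false]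
      rintro ⟨ha, hb⟩
      have hc : (n + t) * q < 0 * q := by linarith
      have hd : (-1) * q < (n + t) * q := by linarith
      have := lt_of_mul_lt_mul_right hc hq.le
      have := lt_of_mul_lt_mul_right hd hq.le
      omega
    rw [hs, Set.ncard_empty, Int.emod_eq_of_lt (by omega) (by omega)]
    push_cast
    ring

theorem count_one_digits_two_pow_mul_div {q d : ℕ} (hd : d < q) (j : ℕ) :
    (q : ℤ) * (Nat.digits 2 (2 ^ j * d / q)).count 1 =
      ∑ i ∈ Finset.range j, ((2 ^ i * d : ℤ) % q) + d - (2 ^ j * d : ℤ) % q := by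
  induction j with
  | zero =>
    rw [pow_zero, one_mul, Nat.div_eq_of_lt hd, pow_zero, one_mul,
      Int.emod_eq_of_lt (by omega) (by omega)]
    simp
  | succ j ih =>
    have hq : 0 < q := by omega
    have hlt := Nat.mod_lt (2 ^ j * d) hq
    have hdm := Nat.mod_add_div (2 ^ j * d) q
    have h : 2 ^ (j + 1) * d = 2 * (2 ^ j * d % q) + q * (2 * (2 ^ j * d / q)) := by
      rw [pow_succ]
      linarith
    have hquot : 2 ^ (j + 1) * d / q = 2 * (2 ^ j * d / q) + 2 * (2 ^ j * d % q) / q := by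
      rw [h, Nat.add_mul_div_left _ _ hq, add_comm]
    have hmod : 2 ^ (j + 1) * d % q = 2 * (2 ^ j * d % q) % q := by
      rw [h, Nat.add_mul_mod_self_left]
    have hdm' := Nat.mod_add_div (2 * (2 ^ j * d % q)) q
    rw [hquot, count_one_digits_two_mul_add _ _ (Nat.div_lt_of_lt_mul (by omega)),
      Finset.sum_range_succ]
    rw [← hmod] at hdm'
    zify at hdm'
    push_cast
    linarith

theorem emod_sub_half {q h : ℤ} (hq : 0 < q) (hh : 2 * h = q + 1) (a : ℤ) :
    (a - h) % q = q - h + (2 * a) % q - a % q := by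
  have h0 := Int.emod_nonneg a hq.ne'
  have h1 := Int.emod_lt_of_pos a hq
  have h2 : (a - h) % q = (a % q - h) % q := ((Int.mod_modEq a q).sub_right h).symm
  have h3 : (2 * a) % q = (2 * (a % q)) % q := ((Int.mod_modEq a q).mul_left 2).symm
  rw [h2, h3]
  set u := a % q
  by_cases hu : u < h
  · rw [← Int.add_emod_right, Int.emod_eq_of_lt (by omega) (by omega),
      Int.emod_eq_of_lt (by omega) (by omega)]
    ring
  · rw [← Int.sub_emod_right (2 * u), Int.emod_eq_of_lt (by omega) (by omega),
      Int.emod_eq_of_lt (by omega) (by omega)]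
    ring

theorem sum_two_pow_mul_sub_half_emod {q h : ℤ} (hq : 0 < q) (hh : 2 * h = q + 1) {m : ℕ}
    (hm : (2 : ℤ) ^ m ≡ 1 [ZMOD q]) (z : ℤ) :
    ∑ i ∈ Finset.range m, (2 ^ i * z - h) % q = m * (q - h) := by
  have hstep (i : ℕ) : (2 ^ i * z - h) % q =
      q - h + ((2 ^ (i + 1) * z) % q - (2 ^ i * z) % q) := by
    rw [emod_sub_half hq hh, show 2 * (2 ^ i * z) = 2 ^ (i + 1) * z by ring]
    ring
  have hz : (2 ^ m * z) % q = (2 ^ 0 * z) % q := by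
    rw [pow_zero]
    exact hm.mul_right z
  simp only [hstep]
  rw [Finset.sum_add_distrib, Finset.sum_range_sub (fun i => (2 ^ i * z) % q), hz]
  simp [mul_sub]

/-- Here the index `k : Fin m` corresponds to `k+1 ∈ {1, …, m}` in the usual
formulation, so `p_k ≡ δ·2^{m-k}` becomes `p k ≡ δ·2^(m-1-k)` and
`r_k ≡ γ - δ̄·2^{k-1}` becomes `r k ≡ γ - δ̄·2^k`.  The multiplicity of the
covering is the number of ones in the binary expansion of `δ(2^m - 1)/q`. -/
theorem multiplicity_theorem (q : ℕ) (hq3 : 3 ≤ q) (hqodd : Odd q)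
    (m : ℕ) (hm : m = orderOf (2 : ZMod q)) (hm3 : 3 ≤ m)
    (δ δbar γ : ℤ) (hδpos : 0 < δ) (hδlt : δ < q) (hδcop : Int.gcd δ q = 1)
    (hδbar : δ * δbar ≡ 1 [ZMOD (q : ℤ)])
    (p r : Fin m → ℤ) (hp : ∀ k, 0 < p k ∧ p k < q)
    (hpk : ∀ k : Fin m, p k ≡ δ * 2 ^ (m - 1 - (k : ℕ)) [ZMOD (q : ℤ)])
    (hrk : ∀ k : Fin m, r k ≡ γ - δbar * 2 ^ (k : ℕ) [ZMOD (q : ℤ)]) :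
    ∀ x : ℤ, ∑ k, beattyCount (p k) q (r k) x
      = (Nat.digits 2 ((δ * (2 ^ m - 1) / q).toNat)).count 1 := by
  intro x
  have hq : (0 : ℤ) < q := by omega
  obtain ⟨s, hs⟩ := hqodd
  set h : ℤ := s + 1 with hh_def
  have hh : 2 * h = q + 1 := by omega
  have h2m : (2 : ℤ) ^ m ≡ 1 [ZMOD (q : ℤ)] := by
    rw [← ZMod.intCast_eq_intCast_iff]
    push_cast
    rw [hm, pow_orderOf_eq_one]
  have h2h : (2 : ℤ) ^ (m - 1) ≡ h [ZMOD (q : ℤ)] := by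
    have e : (2 : ℤ) ^ (m - 1) * (2 * h) = 2 ^ m * h := by
      obtain ⟨n, rfl⟩ : ∃ n, m = n + 1 := ⟨m - 1, by omega⟩
      rw [Nat.add_sub_cancel]
      ring
    calc (2 : ℤ) ^ (m - 1) = 2 ^ (m - 1) * 1 := by ring
      _ ≡ 2 ^ (m - 1) * (2 * h) [ZMOD (q : ℤ)] := by
        refine Int.ModEq.mul_left _ ?_
        rw [hh]
        simp [Int.ModEq]
      _ = 2 ^ m * h := e
      _ ≡ 1 * h [ZMOD (q : ℤ)] := h2m.mul_right h
      _ = h := one_mul h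
  set z := δ * (γ - x) with hz
  have hterm (k : Fin m) : (beattyCount (p k) q (r k) x : ℤ) * q =
      (2 ^ (m - 1 - (k : ℕ)) * (z - δ) - h) % q - (2 ^ (m - 1 - (k : ℕ)) * z - h) % q
        + (2 ^ (m - 1 - (k : ℕ)) * δ) % q := by
    have hpow : (2 : ℤ) ^ (m - 1 - (k : ℕ)) * 2 ^ (k : ℕ) = 2 ^ (m - 1) := by
      rw [← pow_add]
      congr 1
      omega
    have hj : -(p k * (x - r k)) ≡ 2 ^ (m - 1 - (k : ℕ)) * z - h [ZMOD (q : ℤ)] := by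
      calc -(p k * (x - r k))
          ≡ -(δ * 2 ^ (m - 1 - (k : ℕ)) * (x - (γ - δbar * 2 ^ (k : ℕ)))) [ZMOD (q : ℤ)] :=
            ((hpk k).mul ((Int.ModEq.refl x).sub (hrk k))).neg
        _ = 2 ^ (m - 1 - (k : ℕ)) * z - (δ * δbar) * 2 ^ (m - 1) := by
            rw [← hpow, hz]
            ring
        _ ≡ 2 ^ (m - 1 - (k : ℕ)) * z - 1 * h [ZMOD (q : ℤ)] :=
            (Int.ModEq.refl _).sub (hδbar.mul h2h)
        _ = 2 ^ (m - 1 - (k : ℕ)) * z - h := by rw [one_mul]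
    have hjp : -(p k * (x - r k)) - p k ≡
        2 ^ (m - 1 - (k : ℕ)) * (z - δ) - h [ZMOD (q : ℤ)] := by
      convert hj.sub (hpk k) using 1
      ring
    have hpe : p k = (2 ^ (m - 1 - (k : ℕ)) * δ) % q := by
      rw [mul_comm, ← Int.emod_eq_of_lt (hp k).1.le (hp k).2]
      exact hpk k
    rw [beattyCount_mul_eq (hp k).1 (hp k).2, hj, hjp, ← hpe]
  have hsum : (∑ k, (beattyCount (p k) q (r k) x : ℤ)) * q =
      ∑ i ∈ Finset.range m, (2 ^ i * δ) % (q : ℤ) := by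
    rw [Finset.sum_mul, Finset.sum_congr rfl fun k _ => hterm k,
      Fin.sum_univ_eq_sum_range (fun k => (2 ^ (m - 1 - k) * (z - δ) - h) % (q : ℤ)
        - (2 ^ (m - 1 - k) * z - h) % q + (2 ^ (m - 1 - k) * δ) % q) m,
      Finset.sum_range_reflect (fun i => (2 ^ i * (z - δ) - h) % (q : ℤ)
        - (2 ^ i * z - h) % q + (2 ^ i * δ) % q) m,
      Finset.sum_add_distrib, Finset.sum_sub_distrib,
      sum_two_pow_mul_sub_half_emod hq hh h2m, sum_two_pow_mul_sub_half_emod hq hh h2m]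
    ring
  obtain ⟨d, rfl⟩ := Int.eq_ofNat_of_zero_le hδpos.le
  have hmodm : ((2 : ℤ) ^ m * d) % q = d := by
    rw [h2m.mul_right (d : ℤ), one_mul, Int.emod_eq_of_lt hδpos.le hδlt]
  have hN : ((d : ℤ) * (2 ^ m - 1) / q).toNat = 2 ^ m * d / q := by
    have e : (d : ℤ) * (2 ^ m - 1) = q * (2 ^ m * d / q) := by
      have := Int.emod_add_mul_ediv (2 ^ m * d : ℤ) q
      rw [hmodm] at this
      linarith
    rw [e, Int.mul_ediv_cancel_left _ hq.ne']
    exact_mod_cast Int.toNat_natCast _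
  have hc := count_one_digits_two_pow_mul_div (q := q) (d := d) (by exact_mod_cast hδlt) m
  rw [hmodm] at hc
  rw [hN]
  zify
  refine mul_right_cancel₀ hq.ne' ?_
  rw [hsum]
  linarith
end

section
/- Assume the covering setup. If an integer j with j ≢ 0 (mod q) is a multiple of at least one of g_1, …, g_m, then j is a multiple of at least three of g_1, …, g_m (counted with multiplicity, i.e. #{k : g_k divides j} ≥ 3). -/
/-- The `0`-`1` indicator on `ZMod q` of the residues `y` for which `y * p` reduces to a value
below `p`. -/
noncomputable def beattyIndicator (q p : ℕ) (y : ZMod q) : ℂ :=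
  if (y * p).val < p then 1 else 0

/-- The Fourier coefficient at `d` of the (reflected and translated) Beatty indicator. -/
noncomputable def beattyFourier (q p : ℕ) [NeZero q] (r d : ZMod q) : ℂ :=
  ∑ x : ZMod q, ZMod.stdAddChar (d * x) * beattyIndicator q p (r - x)

theorem beattyCount_eq_beattyIndicator {q p : ℕ} [NeZero q] (hp : 0 < p) (hpq : p < q)
    (r x : ℤ) : (beattyCount p q r x : ℂ) = beattyIndicator q p ((r : ZMod q) - x) := by
  have hq : (0 : ℤ) < q := by omega
  have hval : (((((r : ZMod q) - x) * p).val : ℕ) : ℤ) = ((r - x) * p) % q := by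
    rw [← ZMod.val_intCast]
    push_cast
    rfl
  have hset : {n : ℤ | ⌊((n : ℚ) * (q : ℤ) / (p : ℤ) + r)⌋ = x} =
      {n : ℤ | 0 ≤ n * q + (r - x) * p ∧ n * q + (r - x) * p < p} := by
    ext n
    have hp' : (0 : ℚ) < p := by exact_mod_cast hp
    simp only [Set.mem_ofPred_eq, Int.floor_eq_iff, Int.cast_natCast]
    have key : (n : ℚ) * q / p + r - x = ((n * q + (r - x) * p : ℤ) : ℚ) / p := by
      push_cast
      field_simp
      ring
    have h₁ : (x : ℚ) ≤ (n : ℚ) * q / p + r ↔ 0 ≤ n * q + (r - x) * p := by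
      rw [← sub_nonneg, key, le_div_iff₀ hp', zero_mul]
      exact_mod_cast Iff.rfl
    have h₂ : (n : ℚ) * q / p + r < x + 1 ↔ n * q + (r - x) * p < p := by
      rw [← sub_lt_iff_lt_add', key, div_lt_one hp']
      exact_mod_cast Iff.rfl
    rw [h₁, h₂]
  unfold beattyCount beattyIndicator
  rw [hset]
  generalize hA : (r - x) * (p : ℤ) = A at *
  have hdiv := Int.emod_add_mul_ediv A q
  have hnonneg := Int.emod_nonneg A hq.ne'
  split_ifs with h
  · have : {n : ℤ | 0 ≤ n * q + A ∧ n * q + A < p} = {-(A / q)} := by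
      ext n
      simp only [Set.mem_ofPred_eq, Set.mem_singleton_iff]
      constructor
      · rintro ⟨h₁, h₂⟩
        have : 0 ≤ (n + A / q) * q + A % q := by linarith
        have : (n + A / q) * q + A % q < p := by linarith
        have : n + A / q < 1 := by nlinarith
        have : -1 < n + A / q := by nlinarith [Int.emod_lt_of_pos A hq]
        omega
      · rintro rfl
        constructor <;> linarith
    rw [this]
    simp
  · have : {n : ℤ | 0 ≤ n * q + A ∧ n * q + A < p} = ∅ := by
      ext n
      simp only [Set.mem_ofPred_eq, Set.mem_empty_iff_false, iff_false, not_and, not_lt]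
      intro h₁
      have h₂ : (n * q + A) % q = A % q := by rw [Int.mul_comm, Int.mul_add_emod_self_left]
      have h₃ : (n * q + A) % q ≤ n * q + A := by
        have := Int.emod_add_mul_ediv (n * q + A) q
        have := mul_nonneg hq.le (Int.ediv_nonneg h₁ hq.le)
        linarith
      omega
    rw [this]
    simp

/-- The Fourier coefficients of a Beatty sequence vanish off the multiples of `gcd p q`. -/
theorem beattyFourier_eq_zero {q p : ℕ} [NeZero q] (r : ZMod q) {d : ℕ}
    (hd : ¬ p.gcd q ∣ d) : beattyFourier q p r d = 0 := by
  set t : ZMod q := ((q / p.gcd q : ℕ) : ZMod q) with ht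
  have hg : 0 < p.gcd q := Nat.gcd_pos_of_pos_right _ (NeZero.pos q)
  have htp : t * p = 0 := by
    rw [ht, ← Nat.cast_mul, ZMod.natCast_eq_zero_iff]
    calc q = q / p.gcd q * p.gcd q := (Nat.div_mul_cancel (Nat.gcd_dvd_right p q)).symm
      _ ∣ _ := Nat.mul_dvd_mul_left _ (Nat.gcd_dvd_left p q)
  have hdt : (d : ZMod q) * t ≠ 0 := by
    rw [ht, ← Nat.cast_mul, Ne, ZMod.natCast_eq_zero_iff]
    intro h
    apply hd
    have h' : p.gcd q * (q / p.gcd q) ∣ d * (q / p.gcd q) := by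
      rwa [Nat.mul_div_cancel' (Nat.gcd_dvd_right p q)]
    exact Nat.dvd_of_mul_dvd_mul_right
      (Nat.div_pos (Nat.gcd_le_right p (NeZero.pos q)) hg) h'
  have hshift : beattyFourier q p r d = ZMod.stdAddChar ((d : ZMod q) * t) * beattyFourier q p r d := by
    unfold beattyFourier
    rw [Finset.mul_sum, ← Equiv.sum_comp (Equiv.addRight t)]
    refine Finset.sum_congr rfl fun x _ => ?_
    have : beattyIndicator q p (r - (x + t)) = beattyIndicator q p (r - x) := by
      unfold beattyIndicator
      rw [show (r - (x + t)) * p = (r - x) * p - t * p by ring, htp, sub_zero]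
    rw [Equiv.coe_addRight, this, mul_add, AddChar.map_add_eq_mul]
    ring
  by_contra hne
  have h1 : ZMod.stdAddChar ((d : ZMod q) * t) = 1 := by
    have := mul_right_cancel₀ hne ((one_mul _).trans hshift)
    exact this.symm
  exact hdt (ZMod.injective_stdAddChar (h1.trans (AddChar.map_zero_eq_one _).symm))

theorem ite_val_sub_ite_val_sub {q p d : ℕ} [NeZero q] (hd : 0 < d) (hdp : d ∣ p) (hdq : d ∣ q)
    (hp : 0 < p) (hpq : p < q) {u : ZMod q} (hu : d ∣ u.val) :
    ((if u.val < p then 1 else 0) - (if (u - d).val < p then 1 else 0) : ℂ) =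
      (if u = 0 then 1 else 0) - (if u = p then 1 else 0) := by
  have hdle : d ≤ p := Nat.le_of_dvd hp hdp
  have hdval : ((d : ZMod q)).val = d := ZMod.val_natCast_of_lt (by omega)
  have hup : u = p ↔ u.val = p := by
    rw [← ZMod.val_natCast_of_lt hpq, (ZMod.val_injective q).eq_iff,
      ZMod.val_natCast_of_lt hpq]
  by_cases h0 : u = 0
  · subst h0
    have h1 : ((0 : ZMod q) - d).val = q - d := by
      have : (0 : ZMod q) - d = ((q - d : ℕ) : ZMod q) := by
        rw [Nat.cast_sub (by omega)]; simp
      rw [this, ZMod.val_natCast_of_lt (by omega)]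
    have h2 : d ≤ q - p := Nat.le_of_dvd (by omega) (Nat.dvd_sub hdq hdp)
    rw [if_pos (by simpa using hp), if_neg (by omega), if_pos rfl, if_neg]
    rw [hup]
    simp
    omega
  · have hpos : 0 < u.val := Nat.pos_of_ne_zero (by simpa using h0)
    have hle : d ≤ u.val := Nat.le_of_dvd hpos hu
    have h1 : (u - d).val = u.val - d := by rw [ZMod.val_sub (by omega), hdval]
    rw [h1, if_neg h0]
    simp only [hup]
    have h2 : u.val < p + d → p ≤ u.val → u.val = p := by
      intro h3 h4
      have h5 : d ∣ u.val - p := Nat.dvd_sub hu hdp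
      rcases Nat.eq_zero_or_pos (u.val - p) with h | h
      · omega
      · have := Nat.le_of_dvd h h5
        omega
    split_ifs <;> first | omega | simp

/-- The Fourier coefficient of a Beatty sequence at `gcd p q`, up to a unit. -/
theorem one_sub_mul_beattyFourier {q p d : ℕ} [NeZero q] (hp : 0 < p) (hpq : p < q)
    (hd : p.gcd q = d) {e : ZMod q} (he : e * p = d) (r : ZMod q) :
    (1 - ZMod.stdAddChar (-((d : ZMod q) * e))) * beattyFourier q p r d =
      ZMod.stdAddChar ((d : ZMod q) * r) * ((1 - ZMod.stdAddChar (-(d : ZMod q))) *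
        ∑ y : ZMod q, if y * d = 0 then 1 else 0) := by
  have hdp : d ∣ p := hd ▸ Nat.gcd_dvd_left p q
  have hdq : d ∣ q := hd ▸ Nat.gcd_dvd_right p q
  have hd0 : 0 < d := hd ▸ Nat.gcd_pos_of_pos_left _ hp
  obtain ⟨a, ha⟩ := hdp
  have hpa : (p : ZMod q) = a * d := by rw [ha]; push_cast; ring
  have hker (y : ZMod q) : y * p = 0 ↔ y * d = 0 := by
    constructor <;> intro h
    · rw [← he, show y * (e * p) = e * (y * p) by ring, h, mul_zero]
    · rw [hpa, show y * (a * d) = a * (y * d) by ring, h, mul_zero]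
  have hF : beattyFourier q p r d = ZMod.stdAddChar ((d : ZMod q) * r) *
      ∑ y : ZMod q, ZMod.stdAddChar (-((d : ZMod q) * y)) * beattyIndicator q p y := by
    unfold beattyFourier
    rw [Finset.mul_sum, ← Equiv.sum_comp (Equiv.subLeft r)]
    refine Finset.sum_congr rfl fun y _ => ?_
    rw [Equiv.subLeft_apply, sub_sub_cancel, mul_sub, sub_eq_add_neg, AddChar.map_add_eq_mul]
    ring
  have hshift : ZMod.stdAddChar (-((d : ZMod q) * e)) *
      ∑ y : ZMod q, ZMod.stdAddChar (-((d : ZMod q) * y)) * beattyIndicator q p y =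
      ∑ y : ZMod q, ZMod.stdAddChar (-((d : ZMod q) * y)) * beattyIndicator q p (y - e) := by
    rw [Finset.mul_sum, ← Equiv.sum_comp (Equiv.addRight e)
      (fun y : ZMod q => ZMod.stdAddChar (-((d : ZMod q) * y)) * beattyIndicator q p (y - e))]
    refine Finset.sum_congr rfl fun y _ => ?_
    rw [Equiv.coe_addRight, add_sub_cancel_right, mul_add, neg_add, AddChar.map_add_eq_mul]
    ring
  have hdiff (y : ZMod q) : beattyIndicator q p y - beattyIndicator q p (y - e) =
      (if y * p = 0 then 1 else 0) - (if y * p = p then 1 else 0) := by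
    unfold beattyIndicator
    rw [sub_mul, he]
    refine ite_val_sub_ite_val_sub hd0 ⟨a, ha⟩ hdq hp hpq ?_
    rw [ZMod.val_mul, Nat.dvd_mod_iff hdq, ZMod.val_natCast_of_lt hpq]
    exact Dvd.dvd.mul_left ⟨a, ha⟩ _
  have hzero : ∑ y : ZMod q, ZMod.stdAddChar (-((d : ZMod q) * y)) * (if y * p = 0 then 1 else 0) =
      ∑ y : ZMod q, if y * d = 0 then (1 : ℂ) else 0 := by
    refine Finset.sum_congr rfl fun y _ => ?_
    simp only [hker]
    split_ifs with h
    · rw [mul_comm (d : ZMod q), h]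
      simp
    · simp
  have hone : ∑ y : ZMod q, ZMod.stdAddChar (-((d : ZMod q) * y)) * (if y * p = p then 1 else 0) =
      ZMod.stdAddChar (-(d : ZMod q)) *
        ∑ y : ZMod q, ZMod.stdAddChar (-((d : ZMod q) * y)) * (if y * p = 0 then 1 else 0) := by
    rw [Finset.mul_sum, ← Equiv.sum_comp (Equiv.addRight 1)]
    refine Finset.sum_congr rfl fun y _ => ?_
    simp only [Equiv.coe_addRight, add_mul, one_mul, add_eq_right]
    rw [mul_add, mul_one, neg_add, AddChar.map_add_eq_mul]
    ring
  rw [hF, mul_left_comm, sub_mul, one_mul, hshift, ← Finset.sum_sub_distrib]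
  simp only [← mul_sub, hdiff]
  simp only [mul_sub, Finset.sum_sub_distrib]
  rw [hone, hzero]
  ring

theorem eq_or_eq_conj_of_norm_one_sub_eq {a b : ℂ} (ha : ‖a‖ = 1) (hb : ‖b‖ = 1)
    (h : ‖1 - a‖ = ‖1 - b‖) : a = b ∨ a = (starRingEnd ℂ) b := by
  have ha' : a.re * a.re + a.im * a.im = 1 := by
    rw [← Complex.normSq_apply, Complex.normSq_eq_norm_sq, ha, one_pow]
  have hb' : b.re * b.re + b.im * b.im = 1 := by
    rw [← Complex.normSq_apply, Complex.normSq_eq_norm_sq, hb, one_pow]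
  have h' : Complex.normSq (1 - a) = Complex.normSq (1 - b) := by
    rw [Complex.normSq_eq_norm_sq, Complex.normSq_eq_norm_sq, h]
  simp only [Complex.normSq_apply, Complex.sub_re, Complex.sub_im, Complex.one_re,
    Complex.one_im] at h'
  have hre : a.re = b.re := by linarith
  have him : a.im * a.im = b.im * b.im := by rw [hre] at ha'; linarith
  rcases mul_self_eq_mul_self_iff.mp him with h | h
  · exact Or.inl (Complex.ext hre h)
  · exact Or.inr (Complex.ext (by simpa using hre) (by simpa using h))

theorem exists_mul_natCast_eq_gcd (q p : ℕ) : ∃ e : ZMod q, e * p = (p.gcd q : ℕ) := by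
  refine ⟨(p.gcdA q : ℤ), ?_⟩
  have h := congrArg (Int.cast : ℤ → ZMod q) (Nat.gcd_eq_gcd_ab p q)
  push_cast at h
  rw [h, ZMod.natCast_self]
  ring

theorem natCast_gcd_ne_zero {q p : ℕ} (hp : 0 < p) (hpq : p < q) :
    ((p.gcd q : ℕ) : ZMod q) ≠ 0 := by
  rw [Ne, ZMod.natCast_eq_zero_iff]
  intro h
  have h₁ := Nat.le_of_dvd (Nat.gcd_pos_of_pos_left _ hp) h
  have h₂ := Nat.gcd_le_left q hp
  omega

theorem sum_ite_mul_eq_zero_ne_zero {q : ℕ} [NeZero q] (d : ZMod q) :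
    (∑ y : ZMod q, if y * d = 0 then (1 : ℂ) else 0) ≠ 0 := by
  rw [Finset.sum_boole, Nat.cast_ne_zero, Finset.card_ne_zero]
  exact ⟨0, by simp⟩

theorem one_sub_stdAddChar_ne_zero {q : ℕ} [NeZero q] {u : ZMod q} (hu : u ≠ 0) :
    1 - ZMod.stdAddChar u ≠ 0 := by
  rw [sub_ne_zero]
  intro h
  exact hu (ZMod.injective_stdAddChar (h.symm.trans (AddChar.map_zero_eq_one _).symm))

theorem beattyFourier_gcd_ne_zero {q p : ℕ} [NeZero q] (hp : 0 < p) (hpq : p < q) (r : ZMod q) :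
    beattyFourier q p r (p.gcd q : ℕ) ≠ 0 := by
  obtain ⟨e, he⟩ := exists_mul_natCast_eq_gcd q p
  intro h
  have key := one_sub_mul_beattyFourier hp hpq rfl he r
  rw [h, mul_zero] at key
  refine mul_ne_zero (fun h0 => ?_) (mul_ne_zero (one_sub_stdAddChar_ne_zero
    (neg_ne_zero.mpr (natCast_gcd_ne_zero hp hpq))) (sum_ite_mul_eq_zero_ne_zero _)) key.symm
  simpa [h0] using AddChar.norm_apply (ZMod.stdAddChar (N := q)) ((p.gcd q : ℕ) * r)

/-- Two Beatty sequences with the same gcd and cancelling Fourier coefficients there have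
equal or complementary numerators. -/
theorem eq_or_add_eq_of_beattyFourier_add_eq_zero {q p p' : ℕ} [NeZero q] (hp : 0 < p)
    (hpq : p < q) (hp' : 0 < p') (hpq' : p' < q) (hg : p'.gcd q = p.gcd q) (r r' : ZMod q)
    (h : beattyFourier q p r (p.gcd q : ℕ) + beattyFourier q p' r' (p.gcd q : ℕ) = 0) :
    p = p' ∨ p + p' = q := by
  obtain ⟨e, he⟩ := exists_mul_natCast_eq_gcd q p
  obtain ⟨e', he'⟩ := exists_mul_natCast_eq_gcd q p'
  have hne := beattyFourier_gcd_ne_zero hp hpq r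
  have key := one_sub_mul_beattyFourier hp hpq rfl he r
  have key' := one_sub_mul_beattyFourier hp' hpq' rfl he' r'
  rw [hg] at he' key'
  obtain ⟨a, ha⟩ := Nat.gcd_dvd_left p q
  obtain ⟨a', ha'⟩ := hg ▸ Nat.gcd_dvd_left p' q
  generalize p.gcd q = d at *
  have hnorm : ‖1 - ZMod.stdAddChar (-((d : ZMod q) * e))‖ = ‖1 - ZMod.stdAddChar (-((d : ZMod q) * e'))‖ := by
    have h₁ := congrArg norm key
    have h₂ := congrArg norm key'
    rw [← neg_eq_of_add_eq_zero_right h] at h₂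
    simp only [norm_mul, norm_neg, AddChar.norm_apply, one_mul] at h₁ h₂
    exact mul_right_cancel₀ (norm_ne_zero_iff.mpr hne) (h₁.trans h₂.symm)
  have hpa : (p : ZMod q) = d * a := by rw [ha]; push_cast; rfl
  have hpa' : (p' : ZMod q) = d * a' := by rw [ha']; push_cast; rfl
  rcases eq_or_eq_conj_of_norm_one_sub_eq (AddChar.norm_apply _ _) (AddChar.norm_apply _ _) hnorm
    with h₁ | h₁
  · left
    have h₂ : (d : ZMod q) * e = d * e' := neg_injective (ZMod.injective_stdAddChar h₁)
    have h₃ : (p : ZMod q) = p' := by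
      linear_combination hpa - hpa' - a * he' + a' * he + e' * a * hpa' - e * a' * hpa
        - (a * a') * h₂
    have h₄ := congrArg ZMod.val h₃
    rwa [ZMod.val_natCast_of_lt hpq, ZMod.val_natCast_of_lt hpq'] at h₄
  · right
    rw [← AddChar.map_neg_eq_conj, neg_neg] at h₁
    have h₂ : -((d : ZMod q) * e) = d * e' := ZMod.injective_stdAddChar h₁
    have h₃ : (p : ZMod q) + p' = 0 := by
      linear_combination hpa + hpa' - a * he' - a' * he + e' * a * hpa' + e * a' * hpa
        - (a * a') * h₂
    rw [← Nat.cast_add, ZMod.natCast_eq_zero_iff] at h₃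
    obtain ⟨s, hs⟩ := h₃
    have : 0 < s := Nat.pos_of_ne_zero (by rintro rfl; omega)
    have : s < 2 := by by_contra! h2; nlinarith
    obtain rfl : s = 1 := by omega
    omega

/-- In a constant-multiplicity covering the Fourier coefficients cancel at nonzero frequencies. -/
theorem sum_beattyFourier_eq_zero {q : ℕ} [NeZero q] {m : ℕ} {p : Fin m → ℕ} {r : Fin m → ℤ}
    (hp : ∀ k, 0 < p k ∧ p k < q) {c : ℕ}
    (hcover : ∀ x : ℤ, ∑ k, beattyCount (p k) q (r k) x = c) {d : ZMod q} (hd : d ≠ 0) :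
    ∑ k, beattyFourier q (p k) (r k) d = 0 := by
  unfold beattyFourier
  rw [Finset.sum_comm]
  have hc (x : ZMod q) : ∑ k, beattyIndicator q (p k) ((r k : ZMod q) - x) = c := by
    obtain ⟨z, rfl⟩ := ZMod.intCast_surjective x
    rw [← hcover z]
    push_cast
    exact Finset.sum_congr rfl fun k _ =>
      (beattyCount_eq_beattyIndicator (hp k).1 (hp k).2 _ _).symm
  simp only [← Finset.mul_sum, hc]
  rw [← Finset.sum_mul]
  have := AddChar.sum_mulShift d (ZMod.isPrimitive_stdAddChar q)
  simp only [hd, if_false, mul_comm _ d] at this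
  rw [this]
  simp

theorem few_gi (q : ℤ) (hq : 1 < q) (m : ℕ) (p r : Fin m → ℤ)
    (hpinj : Function.Injective p)
    (hp : ∀ k, 0 < p k ∧ p k < q)
    (hgcd : Finset.univ.gcd (fun k => Int.gcd (p k) q) = 1)
    (hpair : ∀ i j : Fin m, i ≠ j → p i + p j ≠ q)
    (c : ℕ) (hc : 0 < c)
    (hcover : ∀ x : ℤ, ∑ k, beattyCount (p k) q (r k) x = c)
    (j : ℤ) (hj : ¬ q ∣ j) (hmult : ∃ k, (Int.gcd (p k) q : ℤ) ∣ j) :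
    3 ≤ (Finset.univ.filter (fun k => (Int.gcd (p k) q : ℤ) ∣ j)).card := by
  lift q to ℕ using by omega
  lift p to Fin m → ℕ using fun k => (hp k).1.le
  simp only [Int.gcd_natCast_natCast] at *
  have hp : ∀ k, 0 < p k ∧ p k < q := fun k => by exact_mod_cast hp k
  have : NeZero q := ⟨by omega⟩
  have hsum (i : Fin m) : ∑ k ∈ Finset.univ.filter (fun k => (p k).gcd q ∣ (p i).gcd q),
      beattyFourier q (p k) (r k) ((p i).gcd q : ℕ) = 0 := by
    rw [← sum_beattyFourier_eq_zero hp hcover (natCast_gcd_ne_zero (hp i).1 (hp i).2)]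
    refine Finset.sum_subset (Finset.subset_univ _) fun k _ hk => beattyFourier_eq_zero _ ?_
    simpa using hk
  have hother (i : Fin m) : ∃ l, l ≠ i ∧ (p l).gcd q ∣ (p i).gcd q := by
    by_contra! hcon
    have hS : Finset.univ.filter (fun k => (p k).gcd q ∣ (p i).gcd q) = {i} := by
      ext k
      simp only [Finset.mem_filter, Finset.mem_univ, true_and, Finset.mem_singleton]
      exact ⟨fun h => by_contra fun hk => hcon k hk h, by rintro rfl; rfl⟩
    have h := hsum i
    rw [hS, Finset.sum_singleton] at h
    exact beattyFourier_gcd_ne_zero (hp i).1 (hp i).2 _ h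
  obtain ⟨i, hi⟩ := hmult
  suffices h : 2 < (Finset.univ.filter (fun k => (p k).gcd q ∣ (p i).gcd q)).card by
    refine h.trans_le (Finset.card_le_card fun k hk => ?_)
    simp only [Finset.mem_filter, Finset.mem_univ, true_and] at hk ⊢
    exact (Int.natCast_dvd_natCast.mpr hk).trans hi
  obtain ⟨l, hli, hl⟩ := hother i
  by_contra hcard
  have hS : {i, l} = Finset.univ.filter (fun k => (p k).gcd q ∣ (p i).gcd q) := by
    refine Finset.eq_of_subset_of_card_le (fun k hk => ?_) ?_
    · simp only [Finset.mem_insert, Finset.mem_singleton] at hk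
      rcases hk with rfl | rfl <;> simp [hl]
    · rw [Finset.card_pair hli.symm]
      omega
  have hgl : (p i).gcd q ∣ (p l).gcd q := by
    obtain ⟨k, hkl, hk⟩ := hother l
    have : k ∈ ({i, l} : Finset (Fin m)) := by
      rw [hS]
      simpa using hk.trans hl
    simp only [Finset.mem_insert, Finset.mem_singleton, hkl, or_false] at this
    exact this ▸ hk
  have h := hsum i
  rw [← hS, Finset.sum_pair hli.symm] at h
  rcases eq_or_add_eq_of_beattyFourier_add_eq_zero (hp i).1 (hp i).2 (hp l).1 (hp l).2
    (Nat.dvd_antisymm hl hgl) _ _ h with h | h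
  · exact hli (hpinj (by simp [h]))
  · exact hpair i l hli.symm (by exact_mod_cast h)
end

section
/- Assume the covering setup, and let g := min{g_1, …, g_m} and n := #{k : g_k = g}. Then: if n = 3 then q ≤ 7g; if n = 4 then q ≤ 17g; if n = 5 then q ≤ 33g; if n = 6 then q ≤ 730g; and in general q ≤ ((n/(e − 1) + 1)^n + 1)·g, where e is Euler's number. -/
theorem beattyCount_eq_ite {p q : ℤ} (hp : 0 < p) (hpq : p < q) (r x : ℤ) :
    beattyCount p q r x = if (-(p * (x - r))) % q < p then 1 else 0 := by
  have hset : ∀ n : ℤ, ⌊((n : ℚ) * q / p + r)⌋ = x ↔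
      p * (x - r) ≤ n * q ∧ n * q < p * (x - r) + p := by
    intro n
    have hp' : (0 : ℚ) < p := by exact_mod_cast hp
    rw [Int.floor_eq_iff, ← sub_le_iff_le_add, le_div_iff₀ hp', ← lt_sub_iff_add_lt,
      div_lt_iff₀ hp']
    constructor
    · rintro ⟨h1, h2⟩
      constructor
      · have : (((x - r) * p : ℤ) : ℚ) ≤ ((n * q : ℤ) : ℚ) := by push_cast; exact h1
        have := Int.cast_le.mp this
        linarith
      · have : ((n * q : ℤ) : ℚ) < (((x + 1 - r) * p : ℤ) : ℚ) := by push_cast; exact h2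
        have := Int.cast_lt.mp this
        linarith
    · rintro ⟨h1, h2⟩
      constructor
      · have : (((x - r) * p : ℤ) : ℚ) ≤ ((n * q : ℤ) : ℚ) := Int.cast_le.mpr (by linarith)
        push_cast at this; exact this
      · have : ((n * q : ℤ) : ℚ) < (((x + 1 - r) * p : ℤ) : ℚ) := Int.cast_lt.mpr (by linarith)
        push_cast at this; exact this
  unfold beattyCount
  simp only [hset]
  set y := p * (x - r)
  have hmod := Int.emod_add_mul_ediv (-y) q
  have hnn := Int.emod_nonneg (-y) (by lia : q ≠ 0)
  have hlt := Int.emod_lt_of_pos (-y) (by lia : 0 < q)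
  have huniq : ∀ n : ℤ, y ≤ n * q → n * q < y + p → n = -((-y) / q) := by
    intro n h1 h2
    have h3 : (n + (-y) / q) * q < 1 * q := by linarith
    have h4 : (-1) * q < (n + (-y) / q) * q := by linarith
    have := lt_of_mul_lt_mul_right h3 (by lia)
    have := lt_of_mul_lt_mul_right h4 (by lia)
    lia
  split_ifs with h
  · rw [Set.ncard_eq_one]
    refine ⟨-((-y) / q), ?_⟩
    ext n
    simp only [Set.mem_ofPred_eq, Set.mem_singleton_iff]
    constructor
    · rintro ⟨h1, h2⟩
      exact huniq n h1 h2
    · rintro rfl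
      constructor <;> linarith
  · convert Set.ncard_empty ℤ
    ext n
    simp only [Set.mem_ofPred_eq, Set.mem_empty_iff_false, iff_false]
    rintro ⟨h1, h2⟩
    have := huniq n h1 h2
    subst this
    exact h (by linarith)

theorem sum_range_add_of_periodic {N : ℕ} {f : ℤ → ℂ} (hf : ∀ x, f (x + N) = f x) (t : ℤ) :
    ∑ x ∈ Finset.range N, f (x + t) = ∑ x ∈ Finset.range N, f x := by
  have hone : ∀ t : ℤ, ∑ x ∈ Finset.range N, f (x + (t + 1)) =
      ∑ x ∈ Finset.range N, f (x + t) := by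
    intro t
    have h1 := Finset.sum_range_succ (fun x : ℕ => f (x + t)) N
    rw [Finset.sum_range_succ'] at h1
    have h2 : f ((N : ℤ) + t) = f (((0 : ℕ) : ℤ) + t) := by
      rw [add_comm, hf]; simp
    rw [h2] at h1
    rw [← add_right_cancel h1]
    refine Finset.sum_congr rfl fun x _ => ?_
    congr 1; push_cast; ring
  induction t using Int.induction_on with
  | zero => simp
  | succ i ih => rw [hone, ih]
  | pred i ih => rw [← ih, ← hone]; simp

theorem sum_zpow_mul_eq_zero_of_periodic {N : ℕ} {ζ : ℂ} (hζ : ζ ≠ 0) (hN : ζ ^ N = 1)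
    {B : ℤ → ℂ} {d : ℤ} (hBN : ∀ x, B (x + N) = B x) (hB : ∀ x, B (x + d) = B x)
    (hd : ζ ^ d ≠ 1) : ∑ x ∈ Finset.range N, ζ ^ (x : ℤ) * B x = 0 := by
  have h := sum_range_add_of_periodic (N := N) (f := fun x => ζ ^ x * B x) (fun x => by
    simp only [hBN, zpow_add₀ hζ, zpow_natCast, hN, mul_one]) d
  simp only [hB, zpow_add₀ hζ] at h
  have h2 : (ζ ^ d - 1) * ∑ x ∈ Finset.range N, ζ ^ (x : ℤ) * B x = 0 := by
    rw [sub_mul, one_mul, sub_eq_zero]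
    refine Eq.trans ?_ h
    rw [Finset.mul_sum]
    exact Finset.sum_congr rfl fun x _ => by ring
  exact (mul_eq_zero.mp h2).resolve_left (sub_ne_zero.mpr hd)

theorem beattyCount_sub_beattyCount_add {g Q p a : ℤ} (hg : 0 < g) (hp : 0 < p) (hpQ : p < Q)
    (ha : Q ∣ a * p - 1) (r x : ℤ) :
    (beattyCount (g * p) (g * Q) r x : ℂ) - beattyCount (g * p) (g * Q) r (x + a) =
      (if Q ∣ x - r then 1 else 0) - (if Q ∣ x + 1 - r then 1 else 0) := by
  have hcount : ∀ x, beattyCount (g * p) (g * Q) r x =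
      if (-(p * (x - r))) % Q < p then 1 else 0 := by
    intro x
    rw [beattyCount_eq_ite (by positivity) (by gcongr)]
    have : -(g * p * (x - r)) = g * (-(p * (x - r))) := by ring
    rw [this, Int.mul_emod_mul_of_pos _ _ hg]
    simp only [mul_lt_mul_iff_right₀ hg]
  have hco : IsCoprime Q p := by
    obtain ⟨t, ht⟩ := ha
    exact ⟨-t, a, by linear_combination ht⟩
  rw [hcount, hcount]
  set e := (-(p * (x - r))) % Q with he
  have hnn : 0 ≤ e := Int.emod_nonneg _ (by lia)
  have hlt : e < Q := Int.emod_lt_of_pos _ (by lia)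
  have h0 : Q ∣ x - r ↔ e = 0 := by
    rw [he, ← Int.dvd_iff_emod_eq_zero, Int.dvd_neg]
    exact ⟨fun h => h.mul_left p, hco.dvd_of_dvd_mul_left⟩
  have h1 : Q ∣ x + 1 - r ↔ e = p := by
    have h : e = p ↔ Q ∣ p * (x + 1 - r) := by
      rw [← Int.emod_eq_of_lt hp.le hpQ, he, Int.emod_eq_of_lt hp.le hpQ]
      nth_rewrite 2 [← Int.emod_eq_of_lt hp.le hpQ]
      rw [show p * (x + 1 - r) = p - -(p * (x - r)) by ring]
      exact Int.modEq_iff_dvd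
    rw [h]
    exact ⟨fun h => h.mul_left p, hco.dvd_of_dvd_mul_left⟩
  have h2 : (-(p * (x + a - r))) % Q = (e - 1) % Q := by
    rw [he, Int.emod_sub_emod]
    refine Int.modEq_iff_dvd.mpr (ha.trans ⟨1, by ring⟩)
  rw [h2]
  rcases eq_or_ne e 0 with h | h
  · have h3 : (e - 1) % Q = Q - 1 := by
      rw [h, ← Int.add_emod_right, Int.emod_eq_of_lt] <;> lia
    rw [h3, if_pos (by lia), if_neg (by lia), if_pos (h0.mpr h),
      if_neg (fun h' => by have := h1.mp h'; lia)]
    simp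
  · have h3 : (e - 1) % Q = e - 1 := Int.emod_eq_of_lt (by lia) (by lia)
    rw [h3, if_neg (mt h0.mp h), if_congr h1 rfl rfl]
    split_ifs <;> first | lia | simp

theorem beattyCount_add_of_dvd {p q d : ℤ} (hp : 0 < p) (hpq : p < q) (hd : q ∣ p * d) (r x : ℤ) :
    beattyCount p q r (x + d) = beattyCount p q r x := by
  rw [beattyCount_eq_ite hp hpq, beattyCount_eq_ite hp hpq]
  have : (-(p * (x + d - r))) % q = (-(p * (x - r))) % q :=
    Int.modEq_iff_dvd.mpr (hd.trans ⟨1, by ring⟩)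
  rw [this]

theorem sum_zpow_mul_beattyCount {N : ℕ} {g Q p a : ℤ} (hN : (N : ℤ) = g * Q) (hg : 0 < g)
    (hp : 0 < p) (hpQ : p < Q) (ha : Q ∣ a * p - 1) {ζ : ℂ} (hζ : ζ ≠ 0) (hζQ : ζ ^ Q = 1)
    (r : ℤ) :
    (1 - ζ ^ (-a)) * ∑ x ∈ Finset.range N, ζ ^ (x : ℤ) * (beattyCount (g * p) (g * Q) r x : ℂ) =
      (∑ x ∈ Finset.range N, if Q ∣ (x : ℤ) then 1 else 0) * (ζ ^ r - ζ ^ (r - 1)) := by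
  have hζN : ζ ^ (N : ℤ) = 1 := by rw [hN, mul_comm, zpow_mul, hζQ, one_zpow]
  have hQN : Q ∣ (N : ℤ) := ⟨g, by rw [hN]; ring⟩
  have hperN : ∀ x, beattyCount (g * p) (g * Q) r (x + N) = beattyCount (g * p) (g * Q) r x :=
    fun x => beattyCount_add_of_dvd (by positivity) (by gcongr) ⟨g * p, by rw [hN]; ring⟩ r x
  have hshift : ∑ x ∈ Finset.range N,
      ζ ^ ((x : ℤ) + a) * (beattyCount (g * p) (g * Q) r (x + a) : ℂ) =
      ∑ x ∈ Finset.range N, ζ ^ (x : ℤ) * (beattyCount (g * p) (g * Q) r x : ℂ) :=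
    sum_range_add_of_periodic
      (f := fun x => ζ ^ x * (beattyCount (g * p) (g * Q) r x : ℂ))
      (fun x => by simp only [zpow_add₀ hζ, hζN, hperN, mul_one]) a
  have hdelta : ∀ s : ℤ, ∑ x ∈ Finset.range N, ζ ^ (x : ℤ) * (if Q ∣ (x : ℤ) - s then 1 else 0) =
      (∑ x ∈ Finset.range N, if Q ∣ (x : ℤ) then 1 else 0) * ζ ^ s := by
    intro s
    rw [← sum_range_add_of_periodic
      (f := fun x => ζ ^ x * (if Q ∣ x - s then 1 else 0)) (fun x => by
        have : Q ∣ x + N - s ↔ Q ∣ x - s := by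
          rw [show x + N - s = x - s + N by ring]
          exact dvd_add_left hQN
        simp only [zpow_add₀ hζ, hζN, mul_one, this]) s, Finset.sum_mul]
    refine Finset.sum_congr rfl fun x _ => ?_
    simp only [add_sub_cancel_right]
    split_ifs with h
    · obtain ⟨t, ht⟩ := h
      rw [zpow_add₀ hζ, ht, zpow_mul, hζQ, one_zpow]
      ring
    · simp
  have hmul : ζ ^ (-a) * ∑ x ∈ Finset.range N,
      ζ ^ (x : ℤ) * (beattyCount (g * p) (g * Q) r x : ℂ) =
      ∑ x ∈ Finset.range N, ζ ^ (x : ℤ) * (beattyCount (g * p) (g * Q) r (x + a) : ℂ) := by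
    rw [← hshift, Finset.mul_sum]
    refine Finset.sum_congr rfl fun x _ => ?_
    rw [← mul_assoc, ← zpow_add₀ hζ]
    congr 2; ring
  rw [sub_mul, one_mul, hmul, ← Finset.sum_sub_distrib, mul_sub, ← hdelta, ← hdelta,
    ← Finset.sum_sub_distrib]
  refine Finset.sum_congr rfl fun x _ => ?_
  rw [← mul_sub, beattyCount_sub_beattyCount_add hg hp hpQ ha, ← mul_sub]
  simp only [show (x : ℤ) - (r - 1) = x + 1 - r by ring]

theorem sum_le_sum_range_of_antitoneOn {f : ℕ → ℝ} {b N : ℕ} (hf : AntitoneOn f (Set.Icc b N))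
    (T : Finset ℕ) (hT : ∀ t ∈ T, b ≤ t ∧ t ≤ N) :
    ∑ t ∈ T, f t ≤ ∑ i ∈ Finset.range T.card, f (b + i) := by
  induction T using Finset.induction_on_max with
  | empty => simp
  | insert a s hs ih =>
    have has : a ∉ s := fun h => lt_irrefl _ (hs a h)
    rw [Finset.sum_insert has, Finset.card_insert_of_notMem has, Finset.sum_range_succ, add_comm]
    have hcard : s.card ≤ a - b := by
      rw [← Nat.card_Ico]
      exact Finset.card_le_card fun t ht =>
        Finset.mem_Ico.mpr ⟨(hT t (Finset.mem_insert_of_mem ht)).1, hs t ht⟩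
    have ha := hT a (Finset.mem_insert_self a s)
    exact add_le_add (ih fun t ht => hT t (Finset.mem_insert_of_mem ht))
      (hf ⟨by lia, by lia⟩ ⟨by lia, by lia⟩ (by lia))

theorem le_pow_card_add_one_of_exists_dvd {ι : Type*} {S : Finset ι} (hS : S.Nonempty)
    {P : ι → ℤ} {Q B : ℕ} (hco : ∀ k ∈ S, IsCoprime (Q : ℤ) (P k))
    (hstep : ∀ k ∈ S, ∃ j ∈ S, ∃ u : ℤ, 2 ≤ |u| ∧ |u| ≤ B ∧ (Q : ℤ) ∣ P k - u * P j) :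
    Q ≤ B ^ S.card + 1 := by
  choose! f hfS u hu2 huB hdvd using hstep
  have hiter : ∀ L : ℕ, ∀ k ∈ S, f^[L] k ∈ S ∧
      ∃ v : ℤ, 2 ^ L ≤ |v| ∧ |v| ≤ B ^ L ∧ (Q : ℤ) ∣ P k - v * P (f^[L] k) := by
    intro L
    induction L with
    | zero => intro k hk; exact ⟨hk, 1, by simp⟩
    | succ L ih =>
      intro k hk
      obtain ⟨hmem, v, hv2, hvB, hv⟩ := ih (f k) (hfS k hk)
      refine ⟨hmem, u k * v, ?_, ?_, ?_⟩
      · rw [abs_mul, pow_succ']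
        exact mul_le_mul (hu2 k hk) hv2 (by positivity) (by positivity)
      · rw [abs_mul, pow_succ']
        exact mul_le_mul (huB k hk) hvB (by positivity) (by positivity)
      · have := dvd_add (hdvd k hk) (hv.mul_left (u k))
        rw [Function.iterate_succ_apply]
        exact this.trans ⟨1, by ring⟩
  obtain ⟨k, hk⟩ := hS
  obtain ⟨i, hi, j, hj, hij, hfij⟩ := Finset.exists_ne_map_eq_of_card_lt_of_maps_to
    (s := Finset.range (S.card + 1)) (t := S) (by simp) (f := fun i => f^[i] k)
    (fun i _ => (hiter i k hk).1)
  wlog hlt : i < j generalizing i j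
  · exact this j hj i hi hij.symm hfij.symm (by lia)
  have hy := (hiter i k hk).1
  obtain ⟨-, v, hv2, hvB, hv⟩ := hiter (j - i) _ hy
  rw [← Function.iterate_add_apply, Nat.sub_add_cancel hlt.le, ← hfij] at hv
  have hv1 : (Q : ℤ) ∣ 1 - v := by
    refine (hco _ hy).dvd_of_dvd_mul_right (hv.trans ⟨1, by ring⟩)
  have hB : 2 ≤ B := by exact_mod_cast (hu2 k hk).trans (huB k hk)
  have hne : 1 - v ≠ 0 := by
    intro h
    have h1 : v = 1 := by lia
    have h2 : (2 : ℤ) ^ 1 ≤ 2 ^ (j - i) := pow_le_pow_right₀ (by norm_num) (by lia)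
    rw [h1] at hv2
    norm_num at hv2 h2
    lia
  have h1 : (Q : ℤ) ≤ |1 - v| := Int.le_of_dvd (abs_pos.mpr hne) ((dvd_abs _ _).mpr hv1)
  have h2 : |1 - v| ≤ 1 + |v| := by simpa using abs_sub (1 : ℤ) v
  have h3 : (B : ℤ) ^ (j - i) ≤ B ^ S.card :=
    pow_le_pow_right₀ (by lia) (by have := Finset.mem_range.mp hj; lia)
  have h4 : (Q : ℤ) ≤ B ^ S.card + 1 := by lia
  exact_mod_cast h4

theorem norm_one_sub_zpow_exp {Q : ℕ} (hQ : 0 < Q) {u : ℤ} (hu : 2 * u.natAbs ≤ Q) :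
    ‖1 - Complex.exp (2 * Real.pi * Complex.I / Q) ^ u‖ =
      2 * Real.sin (u.natAbs * (Real.pi / Q)) := by
  have hQ' : (0 : ℝ) < Q := by exact_mod_cast hQ
  rw [← Complex.exp_int_mul, norm_sub_rev,
    show (u : ℂ) * (2 * Real.pi * Complex.I / Q) = Complex.I * ((2 * (u * (Real.pi / Q)) : ℝ) : ℂ) by
      push_cast; ring, Complex.norm_exp_I_mul_ofReal_sub_one, norm_mul, Real.norm_eq_abs,
    Real.norm_eq_abs, abs_two, mul_div_cancel_left₀ _ two_ne_zero]
  have hnn : 0 ≤ Real.sin (u.natAbs * (Real.pi / Q)) := by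
    refine Real.sin_nonneg_of_nonneg_of_le_pi (by positivity) ?_
    have : ((2 * u.natAbs : ℕ) : ℝ) ≤ Q := by exact_mod_cast hu
    push_cast at this
    rw [mul_div_assoc', div_le_iff₀ hQ', mul_comm]
    have := Real.pi_pos
    gcongr
    linarith
  rcases Int.natAbs_eq u with h | h
  · rw [h, Int.natAbs_natCast, Int.cast_natCast, abs_of_nonneg hnn]
  · rw [h, Int.natAbs_neg, Int.natAbs_natCast, Int.cast_neg, Int.cast_natCast, neg_mul,
      Real.sin_neg, abs_neg, abs_of_nonneg hnn]

theorem exists_dvd_sub_and_two_mul_natAbs_le {Q : ℕ} (hQ : 0 < Q) (c : ℤ) :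
    ∃ u : ℤ, (Q : ℤ) ∣ c - u ∧ 2 * u.natAbs ≤ Q :=
  ⟨c.bmod Q, by
    rw [Int.bmod_eq_self_sub_mul_bdiv]; simp, by
    have h1 := Int.le_bmod (x := c) hQ
    have h2 := Int.bmod_lt (x := c) hQ
    lia⟩

theorem sin_mul_pi_div_pos {Q : ℕ} {u : ℕ} (hu : 0 < u) (huQ : 2 * u ≤ Q) :
    0 < Real.sin (u * (Real.pi / Q)) := by
  have hQ' : (0 : ℝ) < Q := by exact_mod_cast (by lia : 0 < Q)
  have hu' : (0 : ℝ) < u := by exact_mod_cast hu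
  have := Real.pi_pos
  refine Real.sin_pos_of_pos_of_lt_pi (by positivity) ?_
  have h : ((2 * u : ℕ) : ℝ) ≤ Q := by exact_mod_cast huQ
  push_cast at h
  rw [mul_div_assoc', div_lt_iff₀ hQ', mul_comm]
  gcongr
  linarith

theorem inv_sin_le_sum_inv_sin {m : ℕ} {P p r : Fin m → ℤ} {N c g Q : ℕ} (hN : N = g * Q)
    (hg : 0 < g) (hQ : 2 ≤ Q) (hp : ∀ k, 0 < p k ∧ p k < N)
    (hcover : ∀ x : ℤ, ∑ k, beattyCount (p k) N (r k) x = c)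
    (hgle : ∀ k, g ≤ Int.gcd (p k) N) {S : Finset (Fin m)}
    (hS : ∀ k, k ∈ S ↔ Int.gcd (p k) N = g) (hP : ∀ k ∈ S, p k = g * P k)
    (hco : ∀ k ∈ S, IsCoprime (Q : ℤ) (P k)) {k : Fin m} (hk : k ∈ S) :
    ∃ u : Fin m → ℤ, (∀ j ∈ S, u j ≠ 0 ∧ 2 * (u j).natAbs ≤ Q ∧ (Q : ℤ) ∣ P k - u j * P j) ∧
      (Real.sin (Real.pi / Q))⁻¹ ≤
        ∑ j ∈ S.erase k, (Real.sin ((u j).natAbs * (Real.pi / Q)))⁻¹ := by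
  have hNpos : 0 < N := by rw [hN]; positivity
  have hg' : (0 : ℤ) < g := by exact_mod_cast hg
  have hNZ : (N : ℤ) = g * Q := by exact_mod_cast hN
  have hPpos : ∀ j ∈ S, 0 < P j ∧ P j < Q := by
    intro j hj
    have h := hp j
    rw [hP j hj, hNZ] at h
    exact ⟨pos_of_mul_pos_right h.1 hg'.le, lt_of_mul_lt_mul_left h.2 hg'.le⟩
  have hinv : ∀ j ∈ S, ∃ a : ℤ, (Q : ℤ) ∣ a * P j - 1 := by
    intro j hj
    obtain ⟨s, t, hst⟩ := hco j hj
    exact ⟨t, -s, by linear_combination hst⟩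
  choose! a ha using hinv
  choose u hu huQ using fun j => exists_dvd_sub_and_two_mul_natAbs_le (by lia : 0 < Q) (a j * P k)
  have hudvd : ∀ j ∈ S, (Q : ℤ) ∣ P k - u j * P j := by
    intro j hj
    have h := dvd_sub ((hu j).mul_right (P j)) ((ha j hj).mul_left (P k))
    exact h.trans ⟨1, by ring⟩
  have hu0 : ∀ j ∈ S, u j ≠ 0 := by
    intro j hj h0
    have h := hudvd j hj
    rw [h0, zero_mul, sub_zero] at h
    have := Int.isUnit_iff.mp ((hco k hk).isUnit_of_dvd' dvd_rfl h)
    lia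
  refine ⟨u, fun j hj => ⟨hu0 j hj, huQ j, hudvd j hj⟩, ?_⟩
  set ξ : ℂ := Complex.exp (2 * Real.pi * Complex.I / Q) with hξ
  have hprim : IsPrimitiveRoot ξ Q := Complex.isPrimitiveRoot_exp Q (by lia)
  have hξ0 : ξ ≠ 0 := Complex.exp_ne_zero _
  have hξQ : ∀ v w : ℤ, (Q : ℤ) ∣ v - w → ξ ^ v = ξ ^ w := by
    intro v w h
    rw [← sub_add_cancel v w, zpow_add₀ hξ0, (hprim.zpow_eq_one_iff_dvd _).mpr h, one_mul]
  set ζ : ℂ := ξ ^ P k with hζ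
  have hζ0 : ζ ≠ 0 := zpow_ne_zero _ hξ0
  have hζone : ∀ d : ℤ, ζ ^ d = 1 ↔ (Q : ℤ) ∣ d := by
    intro d
    rw [hζ, ← zpow_mul, hprim.zpow_eq_one_iff_dvd]
    exact ⟨(hco k hk).dvd_of_dvd_mul_left, fun h => h.mul_left _⟩
  set F : Fin m → ℂ := fun j =>
    ∑ x ∈ Finset.range N, ζ ^ (x : ℤ) * (beattyCount (p j) N (r j) x : ℂ) with hF
  have hFout : ∀ j, j ∉ S → F j = 0 := by
    intro j hj
    obtain ⟨t, ht⟩ : ((Int.gcd (p j) N : ℕ) : ℤ) ∣ N := Int.gcd_dvd_right ..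
    have hdpos : 0 < Int.gcd (p j) N := by have := hgle j; lia
    obtain ⟨s, hs⟩ : ((Int.gcd (p j) N : ℕ) : ℤ) ∣ p j := Int.gcd_dvd_left ..
    have hζN : ζ ^ N = 1 := by
      rw [← zpow_natCast, hζone, hNZ]; exact dvd_mul_left _ _
    refine sum_zpow_mul_eq_zero_of_periodic hζ0 hζN
      (B := fun x => (beattyCount (p j) N (r j) x : ℂ)) (d := t) ?_ ?_ ?_
    · intro x
      simp only [beattyCount_add_of_dvd (hp j).1 (hp j).2 (dvd_mul_left _ _)]
    · intro x
      have : (N : ℤ) ∣ p j * t := ⟨s, by linear_combination t * hs - s * ht⟩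
      simp only [beattyCount_add_of_dvd (hp j).1 (hp j).2 this]
    · rw [Ne, hζone]
      rintro ⟨w, hw⟩
      have h1 : (g : ℤ) * Q = (Int.gcd (p j) N * w) * Q := by
        rw [← hNZ, mul_assoc, mul_comm w, ← hw, ← ht]
      have h2 := mul_right_cancel₀ (by lia) h1
      have h3 : Int.gcd (p j) N ∣ g := Int.natCast_dvd_natCast.mp ⟨w, h2⟩
      exact hj ((hS j).mpr (le_antisymm (Nat.le_of_dvd hg h3) (hgle j)))
  have hFsum : ∑ j ∈ S, F j = 0 := by
    rw [Finset.sum_subset (Finset.subset_univ S) fun j _ hj => hFout j hj, hF, Finset.sum_comm]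
    have h : ∀ x ∈ Finset.range N,
        ∑ j, ζ ^ (x : ℤ) * (beattyCount (p j) N (r j) x : ℂ) = ζ ^ (x : ℤ) * (c : ℂ) := by
      intro x _
      rw [← Finset.mul_sum, ← hcover x, Nat.cast_sum]
    rw [Finset.sum_congr rfl h]
    refine sum_zpow_mul_eq_zero_of_periodic hζ0 ?_ (B := fun _ => (c : ℂ)) (d := 1)
      (fun _ => rfl) (fun _ => rfl) ?_
    · rw [← zpow_natCast, hζone, hNZ]; exact dvd_mul_left _ _
    · rw [Ne, hζone]
      intro h
      have := Int.le_of_dvd one_pos h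
      lia
  set M : ℕ := ∑ x ∈ Finset.range N, if (Q : ℤ) ∣ (x : ℤ) then 1 else 0 with hM
  have hMpos : 0 < M := by
    refine Finset.sum_pos' (fun _ _ => Nat.zero_le _) ⟨0, Finset.mem_range.mpr hNpos, by simp⟩
  set D : ℝ := M * ‖1 - ζ ^ (-1 : ℤ)‖ with hD
  have hDpos : 0 < D := by
    refine mul_pos (by exact_mod_cast hMpos) (norm_pos_iff.mpr (sub_ne_zero.mpr (Ne.symm ?_)))
    rw [Ne, hζone]
    intro h
    have := Int.le_of_dvd one_pos ((Int.dvd_neg).mp h)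
    lia
  have hFin : ∀ j ∈ S, ‖1 - ζ ^ (-a j)‖ * ‖F j‖ = D := by
    intro j hj
    have h := sum_zpow_mul_beattyCount hNZ hg' (hPpos j hj).1 (hPpos j hj).2 (ha j hj) hζ0
      ((hζone _).mpr dvd_rfl) (r j)
    rw [← hP j hj, ← hNZ] at h
    have hζ1 : ‖ζ‖ = 1 := by
      refine Complex.norm_eq_one_of_pow_eq_one (n := Q) ?_ (by lia)
      rw [← zpow_natCast, hζone]
    rw [← norm_mul, h, sub_eq_add_neg (r j), zpow_add₀ hζ0, ← mul_one_sub, norm_mul, norm_mul,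
      norm_zpow, hζ1, one_zpow, one_mul, hD, hM]
    congr 1
    have : (∑ x ∈ Finset.range N, if (Q : ℤ) ∣ (x : ℤ) then (1 : ℂ) else 0) = (M : ℂ) := by
      rw [hM]; push_cast; rfl
    rw [this, Complex.norm_natCast]
  have hnorm : ∀ j ∈ S, ∀ v : ℤ, (Q : ℤ) ∣ a j * P k - v → v ≠ 0 → 2 * v.natAbs ≤ Q →
      ‖F j‖ = D / 2 * (Real.sin (v.natAbs * (Real.pi / Q)))⁻¹ := by
    intro j hj v hv hv0 hvQ
    have h := hFin j hj
    have hpow : ζ ^ (-a j) = ξ ^ (-v) := by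
      rw [hζ, ← zpow_mul]
      exact hξQ _ _ ((dvd_neg.mpr hv).trans ⟨1, by ring⟩)
    rw [hpow, hξ, norm_one_sub_zpow_exp (by lia) (by rwa [Int.natAbs_neg]), Int.natAbs_neg] at h
    have hpos := sin_mul_pi_div_pos (Int.natAbs_pos.mpr hv0) hvQ
    rw [← h]
    generalize Real.sin (v.natAbs * (Real.pi / Q)) = s at hpos ⊢
    field_simp
  have hle : ‖F k‖ ≤ ∑ j ∈ S.erase k, ‖F j‖ := by
    rw [← Finset.add_sum_erase S F hk] at hFsum
    rw [eq_neg_of_add_eq_zero_left hFsum, norm_neg]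
    exact norm_sum_le _ _
  rw [hnorm k hk 1 (ha k hk) one_ne_zero (by simpa using hQ),
    Finset.sum_congr rfl fun j hj => hnorm j (Finset.mem_of_mem_erase hj) (u j) (hu j)
      (hu0 j (Finset.mem_of_mem_erase hj)) (huQ j), ← Finset.mul_sum] at hle
  have := le_of_mul_le_mul_left hle (by positivity)
  simpa using this

theorem le_pow_card_add_one_of_covering {m : ℕ} {P p r : Fin m → ℤ} {N c g Q B : ℕ}
    (hN : N = g * Q) (hg : 0 < g) (hQ : 2 ≤ Q) (hpinj : Function.Injective p)
    (hp : ∀ k, 0 < p k ∧ p k < N) (hpair : ∀ i j, i ≠ j → p i + p j ≠ N)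
    (hcover : ∀ x : ℤ, ∑ k, beattyCount (p k) N (r k) x = c)
    (hgle : ∀ k, g ≤ Int.gcd (p k) N) {S : Finset (Fin m)} (hSne : S.Nonempty)
    (hS : ∀ k, k ∈ S ↔ Int.gcd (p k) N = g) (hP : ∀ k ∈ S, p k = g * P k)
    (hco : ∀ k ∈ S, IsCoprime (Q : ℤ) (P k)) (hBQ : 2 * B ≤ Q)
    (hsum : 2 * (B + S.card - 1) ≤ Q → ∑ i ∈ Finset.range (S.card - 1),
      (Real.sin ((B + 1 + i : ℕ) * (Real.pi / Q)))⁻¹ < (Real.sin (Real.pi / Q))⁻¹) :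
    2 ≤ B ∧ Q ≤ B ^ S.card + 1 := by
  have hg' : (0 : ℤ) < g := by exact_mod_cast hg
  have hNZ : (N : ℤ) = g * Q := by exact_mod_cast hN
  have hPpos : ∀ j ∈ S, 0 < P j ∧ P j < Q := by
    intro j hj
    have h := hp j
    rw [hP j hj, hNZ] at h
    exact ⟨pos_of_mul_pos_right h.1 hg'.le, lt_of_mul_lt_mul_left h.2 hg'.le⟩
  have hPne : ∀ i ∈ S, ∀ j ∈ S, i ≠ j → ¬ (Q : ℤ) ∣ P i - P j ∧ ¬ (Q : ℤ) ∣ P i + P j := by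
    intro i hi j hj hij
    have hi' := hPpos i hi
    have hj' := hPpos j hj
    constructor
    · intro h
      have h0 := Int.eq_zero_of_abs_lt_dvd h (by rw [abs_lt]; lia)
      exact hij (hpinj (by rw [hP i hi, hP j hj, sub_eq_zero.mp h0]))
    · intro h
      have h0 := Int.eq_zero_of_abs_lt_dvd (dvd_sub_self_right.mpr h) (by rw [abs_lt]; lia)
      refine hpair i j hij ?_
      rw [hP i hi, hP j hj, hNZ]
      linear_combination (g : ℤ) * h0
  have hstep : ∀ k ∈ S, ∃ j ∈ S, ∃ u : ℤ, 2 ≤ |u| ∧ |u| ≤ B ∧ (Q : ℤ) ∣ P k - u * P j := by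
    intro k hk
    obtain ⟨u, hu, hle⟩ := inv_sin_le_sum_inv_sin hN hg hQ hp hcover hgle hS hP hco hk
    by_contra! hcon
    have htwo : ∀ j ∈ S.erase k, 2 ≤ |u j| := by
      intro j hj
      obtain ⟨hjk, hjS⟩ := Finset.mem_erase.mp hj
      obtain ⟨h0, -, hdvd⟩ := hu j hjS
      obtain ⟨hsub, hadd⟩ := hPne k hk j hjS hjk.symm
      by_contra! hlt
      have : u j = 1 ∨ u j = -1 := by
        have := abs_lt.mp hlt
        lia
      rcases this with h | h <;> rw [h] at hdvd
      · exact hsub (by simpa using hdvd)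
      · exact hadd (by simpa using hdvd)
    have hlarge : ∀ j ∈ S.erase k, B + 1 ≤ (u j).natAbs ∧ (u j).natAbs ≤ Q / 2 := by
      intro j hj
      have hjS := Finset.mem_of_mem_erase hj
      have h1 : ¬ |u j| ≤ B := fun h => hcon j hjS (u j) (htwo j hj) h (hu j hjS).2.2
      have h2 := (hu j hjS).2.1
      rw [Int.abs_eq_natAbs] at h1
      lia
    have hinj : Set.InjOn (fun j => (u j).natAbs) (S.erase k) := by
      intro i hi j hj hij
      by_contra hne
      have hiS := Finset.mem_of_mem_erase hi
      have hjS := Finset.mem_of_mem_erase hj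
      have hi3 := (hu i hiS).2.2
      have hj3 := (hu j hjS).2.2
      have hcu : IsCoprime (Q : ℤ) (u i) := by
        obtain ⟨t, ht⟩ := hi3
        obtain ⟨v, w, hvw⟩ := hco k hk
        exact ⟨v + w * t, w * P i, by linear_combination hvw - w * ht⟩
      have hdiff := dvd_sub hj3 hi3
      obtain ⟨hsub, hadd⟩ := hPne i hiS j hjS hne
      rcases Int.natAbs_eq_natAbs_iff.mp hij with h | h
      · refine hsub (hcu.dvd_of_dvd_mul_left (hdiff.trans ⟨1, ?_⟩))
        rw [← h]; ring
      · refine hadd (hcu.dvd_of_dvd_mul_left (hdiff.trans ⟨1, ?_⟩))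
        rw [show u j = -u i by lia]; ring
    have hanti : AntitoneOn (fun t : ℕ => (Real.sin (t * (Real.pi / Q)))⁻¹)
        (Set.Icc (B + 1) (Q / 2)) := by
      intro s hs t ht hst
      have hpos := sin_mul_pi_div_pos (Q := Q) (u := s) (by have := hs.1; lia)
        (by have := hs.2; lia)
      have hQ' : (0 : ℝ) < Q := by exact_mod_cast (by lia : 0 < Q)
      have hpi := Real.pi_pos
      have hst' : (s : ℝ) ≤ t := by exact_mod_cast hst
      have hs0 : (0 : ℝ) ≤ s * (Real.pi / Q) := by positivity
      refine inv_anti₀ hpos (Real.sin_le_sin_of_le_of_le_pi_div_two (by linarith) ?_ (by gcongr))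
      have h : ((2 * t : ℕ) : ℝ) ≤ Q := by exact_mod_cast (by have := ht.2; lia : 2 * t ≤ Q)
      push_cast at h
      rw [mul_div_assoc', div_le_div_iff₀ hQ' two_pos]
      nlinarith
    set T := (S.erase k).image fun j => (u j).natAbs with hT
    have hTcard : T.card = S.card - 1 := by
      rw [hT, Finset.card_image_of_injOn hinj, Finset.card_erase_of_mem hk]
    have hTmem : ∀ t ∈ T, B + 1 ≤ t ∧ t ≤ Q / 2 := by
      intro t ht
      obtain ⟨j, hj, rfl⟩ := Finset.mem_image.mp ht
      exact hlarge j hj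
    have hTle : T.card ≤ Q / 2 - B := by
      have := Finset.card_le_card (fun t ht => Finset.mem_Icc.mpr (hTmem t ht) :
        T ⊆ Finset.Icc (B + 1) (Q / 2))
      rw [Nat.card_Icc] at this
      lia
    have h1 := sum_le_sum_range_of_antitoneOn hanti T hTmem
    rw [hTcard, hT, Finset.sum_image hinj] at h1
    exact absurd (hle.trans h1) (not_le.mpr (hsum (by
      have := Finset.card_pos.mpr hSne
      lia)))
  obtain ⟨k, hk⟩ := hSne
  obtain ⟨j, -, u, h2, hB, -⟩ := hstep k hk
  exact ⟨by exact_mod_cast h2.trans hB, le_pow_card_add_one_of_exists_dvd ⟨k, hk⟩ hco hstep⟩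

theorem inv_sin_mul_le {x t j : ℝ} (hx : 0 < x) (hj : 0 < j) (hxt : x ^ 2 ≤ t)
    (hjt : j ^ 2 * t < 6) :
    (Real.sin (j * x))⁻¹ ≤ x⁻¹ * (j * (1 - j ^ 2 * t / 6))⁻¹ := by
  have h := Real.sin_gt_sub_cube (x := j * x) (by positivity)
  have h1 : 0 < 1 - j ^ 2 * t / 6 := by linarith
  rw [← mul_inv]
  refine inv_anti₀ (by positivity) (le_trans ?_ h.le)
  have h2 : j ^ 2 * x ^ 2 ≤ j ^ 2 * t := by gcongr
  have h3 : 0 < j * x := by positivity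
  nlinarith

theorem sum_inv_sin_lt_of_sum_lt_one {n B : ℕ} {x t : ℝ} (hx : 0 < x) (hx1 : x < Real.pi)
    (hxt : x ^ 2 ≤ t) (hBt : ((B + n : ℕ) : ℝ) ^ 2 * t < 6)
    (hsum : ∑ i ∈ Finset.range n, (((B + 1 + i : ℕ) : ℝ) *
      (1 - ((B + 1 + i : ℕ) : ℝ) ^ 2 * t / 6))⁻¹ < 1) :
    ∑ i ∈ Finset.range n, (Real.sin ((B + 1 + i : ℕ) * x))⁻¹ < (Real.sin x)⁻¹ := by
  have ht : 0 ≤ t := (sq_nonneg x).trans hxt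
  calc ∑ i ∈ Finset.range n, (Real.sin ((B + 1 + i : ℕ) * x))⁻¹
      ≤ ∑ i ∈ Finset.range n, x⁻¹ * (((B + 1 + i : ℕ) : ℝ) *
        (1 - ((B + 1 + i : ℕ) : ℝ) ^ 2 * t / 6))⁻¹ := by
        refine Finset.sum_le_sum fun i hi => inv_sin_mul_le hx (by positivity) hxt ?_
        refine lt_of_le_of_lt ?_ hBt
        have : B + 1 + i ≤ B + n := by have := Finset.mem_range.mp hi; lia
        gcongr
    _ < x⁻¹ := by
        rw [← Finset.mul_sum]
        exact mul_lt_of_lt_one_right (by positivity) hsum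
    _ ≤ (Real.sin x)⁻¹ := inv_anti₀ (Real.sin_pos_of_pos_of_lt_pi hx hx1) (Real.sin_le hx.le)

theorem sum_inv_sin_lt_of_sum_inv_le {n B : ℕ} {x δ : ℝ} (hx : 0 < x) (hx1 : x < Real.pi)
    (hδ : δ < 1) (hBx : ((B + n : ℕ) : ℝ) ^ 2 * x ^ 2 / 6 < δ)
    (hsum : ∑ i ∈ Finset.range n, ((B + 1 + i : ℕ) : ℝ)⁻¹ ≤ 1 - δ) :
    ∑ i ∈ Finset.range n, (Real.sin ((B + 1 + i : ℕ) * x))⁻¹ < (Real.sin x)⁻¹ := by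
  set ε := ((B + n : ℕ) : ℝ) ^ 2 * x ^ 2 / 6 with hε
  refine sum_inv_sin_lt_of_sum_lt_one hx hx1 le_rfl (by linarith) ?_
  calc ∑ i ∈ Finset.range n, (((B + 1 + i : ℕ) : ℝ) *
        (1 - ((B + 1 + i : ℕ) : ℝ) ^ 2 * x ^ 2 / 6))⁻¹
      ≤ ∑ i ∈ Finset.range n, ((B + 1 + i : ℕ) : ℝ)⁻¹ * (1 - ε)⁻¹ := by
        refine Finset.sum_le_sum fun i hi => ?_
        have : B + 1 + i ≤ B + n := by have := Finset.mem_range.mp hi; lia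
        rw [mul_inv]
        have hpos : 0 < 1 - ε := by linarith
        have hle : ((B + 1 + i : ℕ) : ℝ) ^ 2 * x ^ 2 / 6 ≤ ε := by rw [hε]; gcongr
        gcongr
    _ ≤ (1 - δ) * (1 - ε)⁻¹ := by
        rw [← Finset.sum_mul]
        have : 0 < 1 - ε := by linarith
        gcongr
    _ < 1 := by
        rw [← div_eq_mul_inv, div_lt_one (by linarith)]
        linarith

theorem sum_inv_le_log_div {B : ℕ} (hB : 0 < B) (n : ℕ) :
    ∑ i ∈ Finset.range n, ((B + 1 + i : ℕ) : ℝ)⁻¹ ≤ Real.log (((B + n : ℕ) : ℝ) / B) := by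
  have hB' : (0 : ℝ) < B := by exact_mod_cast hB
  induction n with
  | zero => simp [hB'.ne']
  | succ n ih =>
    have h0 : (0 : ℝ) < (B + n : ℕ) := by exact_mod_cast (by lia : 0 < B + n)
    have h1 : (0 : ℝ) < (B + (n + 1) : ℕ) := by positivity
    rw [Finset.sum_range_succ, Real.log_div h1.ne' hB'.ne']
    rw [Real.log_div h0.ne' hB'.ne'] at ih
    have h := Real.log_le_sub_one_of_pos (div_pos h0 h1)
    rw [Real.log_div h0.ne' h1.ne'] at h
    have h2 : ((B + n : ℕ) : ℝ) / (B + (n + 1) : ℕ) - 1 = -((B + 1 + n : ℕ) : ℝ)⁻¹ := by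
      have h3 : ((B + 1 + n : ℕ) : ℝ) = (B + (n + 1) : ℕ) := by push_cast; ring
      rw [h3]
      field_simp
      push_cast
      ring
    linarith

theorem sq_pi_div_le {Q K : ℕ} (hK : 0 < K) (hKQ : K ≤ Q) :
    (Real.pi / Q) ^ 2 ≤ (3.1416 / K : ℝ) ^ 2 := by
  have := Real.pi_pos
  have := Real.pi_lt_d4
  gcongr

theorem sum_inv_le_one_sub {n B : ℕ} (hn : 0 < n) (hB : (n : ℝ) / (Real.exp 1 - 1) ≤ B) :
    ∑ i ∈ Finset.range (n - 1), ((B + 1 + i : ℕ) : ℝ)⁻¹ ≤ 1 - 0.6 / n := by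
  have he := Real.exp_one_gt_d9
  have hn' : (0 : ℝ) < n := by exact_mod_cast hn
  have hB' : (0 : ℝ) < B := lt_of_lt_of_le (div_pos hn' (by linarith)) hB
  refine (sum_inv_le_log_div (by exact_mod_cast hB') _).trans ?_
  rw [div_le_iff₀ (by linarith)] at hB
  have hcast : ((B + (n - 1) : ℕ) : ℝ) = B + n - 1 := by
    rw [Nat.cast_add, Nat.cast_sub hn]; push_cast; ring
  have hpos : (0 : ℝ) < ((B + (n - 1) : ℕ) : ℝ) / B := by
    have hBpos : 0 < B := Nat.cast_pos.mp hB'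
    exact div_pos (Nat.cast_pos.mpr (by lia)) hB'
  have h := Real.log_le_sub_one_of_pos (div_pos hpos (Real.exp_pos 1))
  rw [Real.log_div hpos.ne' (Real.exp_pos 1).ne', Real.log_exp] at h
  have h2 : ((B + (n - 1) : ℕ) : ℝ) / B / Real.exp 1 ≤ 1 - 0.6 / n := by
    rw [hcast, div_div, div_le_iff₀ (by positivity)]
    have h1n : (1 : ℝ) ≤ n := by exact_mod_cast hn
    have h3 : (n - 1 : ℝ) ≤ (B : ℝ) * (Real.exp 1 - 1) * (1 - 1 / n) := by
      have : (0 : ℝ) ≤ 1 - 1 / n := by rw [sub_nonneg, div_le_one hn']; exact h1n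
      calc (n - 1 : ℝ) = n * (1 - 1 / n) := by field_simp
        _ ≤ _ := by gcongr
    have h4 : 0 ≤ (B : ℝ) * (0.4 * Real.exp 1 - 1) * (1 / n) := by
      have : 0 ≤ 0.4 * Real.exp 1 - 1 := by linarith
      positivity
    have h5 : (0.6 : ℝ) / n = 0.6 * (1 / n) := by ring
    rw [h5]
    nlinarith
  linarith

theorem quotient_bounds {n Q : ℕ} (hn : 0 < n) (hQ : 2 ≤ Q)
    (key : ∀ B : ℕ, 2 * B ≤ Q → (2 * (B + n - 1) ≤ Q → ∑ i ∈ Finset.range (n - 1),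
      (Real.sin ((B + 1 + i : ℕ) * (Real.pi / Q)))⁻¹ < (Real.sin (Real.pi / Q))⁻¹) →
      2 ≤ B ∧ Q ≤ B ^ n + 1) :
    (n = 3 → Q ≤ 7) ∧ (n = 4 → Q ≤ 17) ∧ (n = 5 → Q ≤ 33) ∧ (n = 6 → Q ≤ 730) ∧
      (Q : ℝ) ≤ ((n : ℝ) / (Real.exp 1 - 1) + 1) ^ n + 1 := by
  have hQ' : (0 : ℝ) < Q := by exact_mod_cast (by lia : 0 < Q)
  have hpi := Real.pi_pos
  have hx : 0 < Real.pi / Q := by positivity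
  have hx1 : Real.pi / Q < Real.pi :=
    div_lt_self hpi (by exact_mod_cast (by lia : 1 < Q))
  have hone : n ≠ 1 := by
    rintro rfl
    have := (key 1 (by lia) fun _ => by
      simpa using Real.sin_pos_of_pos_of_lt_pi hx hx1).1
    lia
  have htwo : n ≠ 2 := by
    rintro rfl
    have := (key 1 (by lia) fun h => by
      have h4 : (4 : ℝ) ≤ Q := by exact_mod_cast h
      have h5 : 2 * (Real.pi / Q) ≤ Real.pi / 2 := by
        rw [mul_div_assoc', div_le_div_iff₀ hQ' two_pos]
        nlinarith
      simpa [one_add_one_eq_two] using inv_strictAnti₀ (Real.sin_pos_of_pos_of_lt_pi hx hx1)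
        (Real.sin_lt_sin_of_lt_of_le_pi_div_two (x := Real.pi / Q) (by linarith) h5
          (by linarith))).1
    lia
  have hthree : n = 3 → Q ≤ 7 := by
    rintro rfl
    by_contra! h
    have := (key 1 (by lia) fun _ => by
      refine sum_inv_sin_lt_of_sum_lt_one hx hx1 (sq_pi_div_le (K := 8) (by lia) h) ?_ ?_
      · norm_num
      · norm_num [Finset.sum_range_succ]).1
    lia
  have hfour : n = 4 → Q ≤ 17 := by
    rintro rfl
    by_contra! h
    have := (key 2 (by lia) fun _ => by
      refine sum_inv_sin_lt_of_sum_lt_one hx hx1 (sq_pi_div_le (K := 18) (by lia) h) ?_ ?_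
      · norm_num
      · norm_num [Finset.sum_range_succ]).2
    lia
  have hfive : n = 5 → Q ≤ 33 := by
    rintro rfl
    by_contra! h
    have := (key 2 (by lia) fun _ => by
      refine sum_inv_sin_lt_of_sum_lt_one hx hx1 (sq_pi_div_le (K := 34) (by lia) h) ?_ ?_
      · norm_num
      · norm_num [Finset.sum_range_succ]).2
    lia
  have hsix : n = 6 → Q ≤ 730 := by
    rintro rfl
    by_contra! h
    have := (key 3 (by lia) fun _ => by
      refine sum_inv_sin_lt_of_sum_lt_one hx hx1 (sq_pi_div_le (K := 731) (by lia) h) ?_ ?_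
      · norm_num
      · norm_num [Finset.sum_range_succ]).2
    lia
  refine ⟨hthree, hfour, hfive, hsix, ?_⟩
  have he := Real.exp_one_gt_d9
  have he' := Real.exp_one_lt_d9
  set β : ℝ := (n : ℝ) / (Real.exp 1 - 1) + 1 with hβ
  have hn' : (0 : ℝ) < n := by exact_mod_cast hn
  have hβlo : 0.58 * n + 1 ≤ β := by
    rw [hβ, add_le_add_iff_right, le_div_iff₀ (by linarith)]
    nlinarith
  have hβhi : β ≤ 0.6 * n + 1 := by
    rw [hβ, add_le_add_iff_right, div_le_iff₀ (by linarith)]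
    nlinarith
  have hsmall : ∀ K : ℕ, Q ≤ K → (K : ℝ) ≤ (0.58 * n + 1) ^ n + 1 → (Q : ℝ) ≤ β ^ n + 1 := by
    intro K hK h
    have h1 : (Q : ℝ) ≤ K := by exact_mod_cast hK
    have h2 : (0.58 * n + 1 : ℝ) ^ n ≤ β ^ n := by gcongr
    linarith
  rcases le_or_gt n 6 with h6 | h7
  · interval_cases n
    · exact absurd rfl hone
    · exact absurd rfl htwo
    · exact hsmall 7 (hthree rfl) (by norm_num)
    · exact hsmall 17 (hfour rfl) (by norm_num)
    · exact hsmall 33 (hfive rfl) (by norm_num)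
    · exact hsmall 730 (hsix rfl) (by norm_num)
  by_contra! hlt
  have h7' : (7 : ℝ) ≤ n := by exact_mod_cast h7
  have hQbig : (n : ℝ) ^ 4 / 16 < Q := by
    have h1 : ((n : ℝ) / 2) ^ 4 ≤ β ^ 4 := by gcongr; linarith
    have h2 : β ^ 4 ≤ β ^ n := pow_le_pow_right₀ (by linarith) (by lia)
    have h3 : ((n : ℝ) / 2) ^ 4 = (n : ℝ) ^ 4 / 16 := by ring
    linarith
  have hn3 : (343 : ℝ) ≤ (n : ℝ) ^ 3 := by
    calc (343 : ℝ) = 7 ^ 3 := by norm_num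
      _ ≤ _ := by gcongr
  have hQlin : (20 : ℝ) * n < Q := by
    have : (n : ℝ) ^ 4 = n ^ 3 * n := by ring
    nlinarith
  set B : ℕ := ⌊β⌋₊ with hB
  have hBle : (B : ℝ) ≤ β := Nat.floor_le (by linarith)
  have hBge : (n : ℝ) / (Real.exp 1 - 1) ≤ B := by
    have := Nat.lt_floor_add_one β
    linarith
  have hfin := (key B (by
      have : (2 * B : ℝ) ≤ Q := by linarith
      exact_mod_cast this) fun _ => by
    refine sum_inv_sin_lt_of_sum_inv_le (δ := 0.6 / n) hx hx1 ?_ ?_ (sum_inv_le_one_sub hn hBge)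
    · rw [div_lt_one hn']; linarith
    · have hcast : ((B + (n - 1) : ℕ) : ℝ) ≤ 1.6 * n := by
        rw [Nat.cast_add, Nat.cast_sub hn]; push_cast; linarith
      have hpi2 : Real.pi ^ 2 ≤ 10 := by
        have := Real.pi_lt_d2
        nlinarith
      calc ((B + (n - 1) : ℕ) : ℝ) ^ 2 * (Real.pi / Q) ^ 2 / 6
          ≤ (1.6 * n) ^ 2 * (10 / (Q : ℝ) ^ 2) / 6 := by rw [div_pow]; gcongr
        _ ≤ (1.6 * n) ^ 2 * (10 / ((n : ℝ) ^ 4 / 16) ^ 2) / 6 := by gcongr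
        _ < 0.6 / n := by
          have h5 : (16807 : ℝ) ≤ (n : ℝ) ^ 5 := by
            calc (16807 : ℝ) = 7 ^ 5 := by norm_num
              _ ≤ _ := by gcongr
          have h8 : (1.6 * n) ^ 2 * (10 / ((n : ℝ) ^ 4 / 16) ^ 2) / 6 =
              (1.6 ^ 2 * 2560 / 6 / (n : ℝ) ^ 5) / n := by
            field_simp
            ring
          rw [h8]
          gcongr
          rw [div_lt_iff₀ (by positivity)]
          linarith).2
  have h1 : (Q : ℝ) ≤ (B : ℝ) ^ n + 1 := by exact_mod_cast hfin
  have h2 : (B : ℝ) ^ n ≤ β ^ n := by gcongr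
  linarith

theorem q_bound (q : ℤ) (hq : 1 < q) (m : ℕ) (p r : Fin m → ℤ)
    (hpinj : Function.Injective p)
    (hp : ∀ k, 0 < p k ∧ p k < q)
    (hgcd : Finset.univ.gcd (fun k => Int.gcd (p k) q) = 1)
    (hpair : ∀ i j : Fin m, i ≠ j → p i + p j ≠ q)
    (c : ℕ) (hc : 0 < c)
    (hcover : ∀ x : ℤ, ∑ k, beattyCount (p k) q (r k) x = c)
    (g : ℕ) (hgle : ∀ k, g ≤ Int.gcd (p k) q) (hgmem : ∃ k, Int.gcd (p k) q = g)
    (n : ℕ) (hn : n = (Finset.univ.filter (fun k => Int.gcd (p k) q = g)).card) :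
    (n = 3 → q ≤ 7 * g) ∧ (n = 4 → q ≤ 17 * g) ∧ (n = 5 → q ≤ 33 * g) ∧
    (n = 6 → q ≤ 730 * g) ∧
    (q : ℝ) ≤ (((n : ℝ) / (Real.exp 1 - 1) + 1) ^ n + 1) * g := by
  lift q to ℕ using by lia with N
  set S := Finset.univ.filter fun k => Int.gcd (p k) N = g with hSdef
  have hS : ∀ k, k ∈ S ↔ Int.gcd (p k) N = g := by simp [hSdef]
  obtain ⟨k₀, hk₀⟩ := hgmem
  have hg : 0 < g := by
    rw [← hk₀]
    exact Int.gcd_pos_of_ne_zero_left _ (hp k₀).1.ne'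
  have hSne : S.Nonempty := ⟨k₀, (hS k₀).mpr hk₀⟩
  obtain ⟨Q, hN⟩ : g ∣ N := by
    rw [← hk₀]
    exact_mod_cast Int.gcd_dvd_right (p k₀) (N : ℤ)
  have hg' : (0 : ℤ) < g := by exact_mod_cast hg
  have hP : ∀ k ∈ S, p k = g * (p k / g) := by
    intro k hk
    rw [Int.mul_ediv_cancel']
    rw [← (hS k).mp hk]
    exact Int.gcd_dvd_left ..
  have hco : ∀ k ∈ S, IsCoprime (Q : ℤ) (p k / g) := by
    intro k hk
    have h := (hS k).mp hk
    rw [hP k hk, hN, Nat.cast_mul, Int.gcd_mul_left, Int.natAbs_natCast] at h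
    rw [isCoprime_comm, Int.isCoprime_iff_gcd_eq_one]
    exact Nat.eq_of_mul_eq_mul_left hg (by rw [h, mul_one])
  have hQ : 2 ≤ Q := by
    have h1 : (g : ℤ) ≤ p k₀ :=
      Int.le_of_dvd (hp k₀).1 (by rw [← hk₀]; exact Int.gcd_dvd_left ..)
    have h2 := (hp k₀).2
    by_contra! h
    have h3 : g * Q ≤ g * 1 := Nat.mul_le_mul_left g (by lia)
    lia
  obtain ⟨h3, h4, h5, h6, hgen⟩ := quotient_bounds (n := n) (Q := Q)
    (by rw [hn]; exact Finset.card_pos.mpr hSne) hQ fun B hBQ hsum => by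
      rw [hn] at hsum ⊢
      exact le_pow_card_add_one_of_covering hN hg hQ hpinj hp hpair hcover hgle hSne hS hP hco
        hBQ hsum
  have hle : ∀ K : ℕ, Q ≤ K → (N : ℤ) ≤ K * g := by
    intro K hK
    rw [hN, mul_comm]
    exact_mod_cast Nat.mul_le_mul_right g hK
  refine ⟨fun h => hle 7 (h3 h), fun h => hle 17 (h4 h), fun h => hle 33 (h5 h),
    fun h => hle 730 (h6 h), ?_⟩
  rw [Int.cast_natCast, hN, Nat.cast_mul, mul_comm]
  gcongr
end
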